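/- Let X be a Peano continuum having a free arc, which is neither an arc nor a circle, having no maximal free open interval of Type I, and let F be a commutative subsemigroup of C^0(X) consisting of continuous open maps that is sensitive with sensitivity constant c > 0. Then there exist a free arc A_1 of X and f_1 ∈ F such that A_1 is a jumping arc of {f_1}, with A_1 and f_1(A_1) contained in the same maximal free open interval of X. -/

import Mathlib

open Set Metric Topology

/-- The whole space `X` is an arc, i.e. homeomorphic to `[0,1]`. -/
def SpaceIsArc (X : Type*) [TopologicalSpace X] : Prop :=
  Nonempty (X ≃ₜ Set.Icc (0:ℝ) 1)

/-- The whole space `X` is a circle, i.e. homeomorphic to the unit circle in `ℂ`. -/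
def SpaceIsCircle (X : Type*) [TopologicalSpace X] : Prop :=
  Nonempty (X ≃ₜ Metric.sphere (0:ℂ) 1)

/-- A subset `A` is an arc: with the subspace topology it is homeomorphic to `[0,1]`. -/
def IsArc {X : Type*} [TopologicalSpace X] (A : Set X) : Prop :=
  Nonempty (A ≃ₜ Set.Icc (0:ℝ) 1)

/-- A subset `A` is a circle: with the subspace topology it is homeomorphic to `S¹`. -/
def IsCircleSet {X : Type*} [TopologicalSpace X] (A : Set X) : Prop :=
  Nonempty (A ≃ₜ Metric.sphere (0:ℂ) 1)

/-- `A` is an arc with endpoints `a` and `b`: it is the image of a continuous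
injective parametrization of `[0,1]` with `γ 0 = a` and `γ 1 = b`. -/
def IsArcEnds {X : Type*} [TopologicalSpace X] (A : Set X) (a b : X) : Prop :=
  ∃ γ : ℝ → X, ContinuousOn γ (Set.Icc 0 1) ∧ Set.InjOn γ (Set.Icc 0 1) ∧
    γ '' Set.Icc 0 1 = A ∧ γ 0 = a ∧ γ 1 = b

/-- A free open interval: an open subset homeomorphic to `(0,1)`. -/
def IsFreeOpenInterval {X : Type*} [TopologicalSpace X] (J : Set X) : Prop :=
  IsOpen J ∧ Nonempty (J ≃ₜ Set.Ioo (0:ℝ) 1)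

/-- A free arc: the closure of a free open interval, homeomorphic to `[0,1]`. -/
def IsFreeArc {X : Type*} [TopologicalSpace X] (A : Set X) : Prop :=
  ∃ J : Set X, IsFreeOpenInterval J ∧ A = closure J ∧ IsArc A

/-- A maximal free open interval: no free open interval properly contains it. -/
def IsMaxFreeOpenInterval {X : Type*} [TopologicalSpace X] (J : Set X) : Prop :=
  IsFreeOpenInterval J ∧ ∀ K : Set X, IsFreeOpenInterval K → J ⊆ K → J = K

/-- `x` is an endpoint of the space `X`: every open set containing `x` contains an
open neighborhood of `x` whose boundary is a single point. -/
def IsEndpointOf (X : Type*) [TopologicalSpace X] (x : X) : Prop :=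
  ∀ U : Set X, IsOpen U → x ∈ U → ∃ V : Set X, IsOpen V ∧ x ∈ V ∧ V ⊆ U ∧
    ∃ y : X, frontier V = {y}

/-- A maximal free open interval of Type I: its closure is an arc `J ∪ {a,b}` with
`a, b ∉ J` and at least one of `a, b` an endpoint of `X`. -/
def IsTypeI {X : Type*} [TopologicalSpace X] (J : Set X) : Prop :=
  IsMaxFreeOpenInterval J ∧ ∃ a b : X, a ≠ b ∧ a ∉ J ∧ b ∉ J ∧
    closure J = J ∪ {a, b} ∧ IsArcEnds (closure J) a b ∧
    (IsEndpointOf X a ∨ IsEndpointOf X b)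

/-- The model simple triod in the complex plane: three unit segments from the
origin in directions `π/3`, `π`, `5π/3`. -/
noncomputable def triodModel : Set ℂ :=
  ⋃ θ ∈ ({Real.pi / 3, Real.pi, 5 * Real.pi / 3} : Set ℝ),
    (fun r : ℝ => (r : ℂ) * Complex.exp (θ * Complex.I)) '' Set.Icc (0:ℝ) 1

/-- `A` is a simple triod. -/
def IsSimpleTriod {X : Type*} [TopologicalSpace X] (A : Set X) : Prop :=
  Nonempty (A ≃ₜ triodModel)

/-- `U` contains no simple triod. -/
def ContainsNoTriod {X : Type*} [TopologicalSpace X] (U : Set X) : Prop :=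
  ∀ A : Set X, A ⊆ U → ¬ IsSimpleTriod A

/-- The distance between two subsets of a metric space:
`d(S,T) = inf { dist s t | s ∈ S, t ∈ T }`. -/
noncomputable def setDist {X : Type*} [MetricSpace X] (S T : Set X) : ℝ :=
  sInf (Set.image2 dist S T)

open Filter

section RealLine

/-- Invariance of domain on the real line. -/
theorem isOpen_image_of_continuousOn_injOn {g : ℝ → ℝ} {S : Set ℝ} (hS : IsOpen S)
    (hg : ContinuousOn g S) (hi : InjOn g S) : IsOpen (g '' S) := by
  rw [isOpen_iff_mem_nhds]
  rintro _ ⟨t, ht, rfl⟩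
  obtain ⟨η, hη, hsub⟩ := Metric.isOpen_iff.1 hS t ht
  have hI : Icc (t - η / 2) (t + η / 2) ⊆ S := fun u hu => hsub (by
    rw [Real.ball_eq_Ioo]; exact ⟨by linarith [hu.1], by linarith [hu.2]⟩)
  have hle : t - η / 2 ≤ t + η / 2 := by linarith
  have hIoo : Ioo (t - η / 2) (t + η / 2) ⊆ S := Ioo_subset_Icc_self.trans hI
  have m1 : t - η / 2 ∈ Icc (t - η / 2) (t + η / 2) := ⟨le_rfl, hle⟩
  have m2 : t + η / 2 ∈ Icc (t - η / 2) (t + η / 2) := ⟨hle, le_rfl⟩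
  have m3 : t ∈ Icc (t - η / 2) (t + η / 2) := ⟨by linarith, by linarith⟩
  rcases (hg.mono hI).strictMonoOn_of_injOn_Icc' hle (hi.mono hI) with h | h
  · exact mem_of_superset
      (Ioo_mem_nhds (h m1 m3 (by linarith)) (h m3 m2 (by linarith)))
      ((intermediate_value_Ioo hle (hg.mono hI)).trans (image_mono hIoo))
  · exact mem_of_superset
      (Ioo_mem_nhds (h m3 m2 (by linarith)) (h m1 m3 (by linarith)))
      ((intermediate_value_Ioo' hle (hg.mono hI)).trans (image_mono hIoo))

theorem isOpenEmbedding_of_continuous_injective {g : ℝ → ℝ} (hg : Continuous g)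
    (hi : Function.Injective g) : IsOpenEmbedding g :=
  .of_continuous_injective_isOpenMap hg hi fun _ hU =>
    isOpen_image_of_continuousOn_injOn hU hg.continuousOn hi.injOn

/-- A parametrization of the open interval `(a, b)` by the real line. -/
noncomputable def lineToIoo (a b t : ℝ) : ℝ := (a + b) / 2 + (b - a) / Real.pi * Real.arctan t

theorem lineToIoo_strictMono {a b : ℝ} (hab : a < b) : StrictMono (lineToIoo a b) := by
  intro s t hst
  have h1 : 0 < (b - a) / Real.pi := div_pos (by linarith) Real.pi_pos
  have := mul_lt_mul_of_pos_left (Real.arctan_strictMono hst) h1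
  simp only [lineToIoo]; linarith

theorem continuous_lineToIoo (a b : ℝ) : Continuous (lineToIoo a b) := by
  unfold lineToIoo; fun_prop

theorem isOpenEmbedding_lineToIoo {a b : ℝ} (hab : a < b) : IsOpenEmbedding (lineToIoo a b) :=
  isOpenEmbedding_of_continuous_injective (continuous_lineToIoo a b)
    (lineToIoo_strictMono hab).injective

theorem range_lineToIoo {a b : ℝ} (hab : a < b) : range (lineToIoo a b) = Ioo a b := by
  have h1 : 0 < b - a := by linarith
  have hpi := Real.pi_pos
  ext x
  have key : x ∈ Ioo a b ↔
      (x - (a + b) / 2) / ((b - a) / Real.pi) ∈ Ioo (-(Real.pi / 2)) (Real.pi / 2) := by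
    rw [mem_Ioo, mem_Ioo, lt_div_iff₀ (by positivity), div_lt_iff₀ (by positivity)]
    have : Real.pi / 2 * ((b - a) / Real.pi) = (b - a) / 2 := by field_simp
    rw [neg_mul, this]
    constructor <;> rintro ⟨h, h'⟩ <;> constructor <;> linarith
  rw [key, ← Real.range_arctan]
  constructor
  · rintro ⟨t, rfl⟩
    refine ⟨t, ?_⟩
    simp only [lineToIoo]
    field_simp
    ring
  · rintro ⟨t, ht⟩
    refine ⟨t, ?_⟩
    simp only [lineToIoo, ht]
    field_simp
    ring

theorem eq_Ioo_of_isOpen_ordConnected {S : Set ℝ} (hS : IsOpen S) (hc : S.OrdConnected)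
    (hne : S.Nonempty) (ha : BddBelow S) (hb : BddAbove S) : ∃ a b, a < b ∧ S = Ioo a b := by
  have hlt : ∀ x ∈ S, sInf S < x ∧ x < sSup S := by
    intro x hx
    obtain ⟨η, hη, hsub⟩ := Metric.isOpen_iff.1 hS x hx
    rw [Real.ball_eq_Ioo] at hsub
    have h1 := csInf_le ha (hsub (mem_Ioo.2 ⟨by linarith, by linarith⟩ : x - η / 2 ∈ Ioo (x - η) (x + η)))
    have h2 := le_csSup hb (hsub (mem_Ioo.2 ⟨by linarith, by linarith⟩ : x + η / 2 ∈ Ioo (x - η) (x + η)))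
    constructor <;> linarith
  obtain ⟨x, hx⟩ := hne
  refine ⟨sInf S, sSup S, (hlt x hx).1.trans (hlt x hx).2, Subset.antisymm hlt ?_⟩
  rintro y ⟨h1, h2⟩
  obtain ⟨u, hu, huy⟩ := exists_lt_of_csInf_lt ⟨x, hx⟩ h1
  obtain ⟨v, hv, hyv⟩ := exists_lt_of_lt_csSup ⟨x, hx⟩ h2
  exact hc.out hu hv ⟨huy.le, hyv.le⟩

theorem exists_continuous_strictMono_extension_Ioo {α β : ℝ} (hαβ : α < β) {g : ℝ → ℝ}
    (hg : ContinuousOn g (Ioo α β)) (hm : StrictMonoOn g (Ioo α β))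
    (hb : Bornology.IsBounded (g '' Ioo α β)) :
    ∃ G : ℝ → ℝ, Continuous G ∧ StrictMono G ∧ EqOn G g (Ioo α β) := by
  have hne : (Ioo α β).Nonempty := nonempty_Ioo.2 hαβ
  have hE := continuousOn_Icc_extendFrom_Ioo hg
    (hm.monotoneOn.tendsto_nhdsWithin_Ioo_right hne hb.bddBelow)
    (hm.monotoneOn.tendsto_nhdsWithin_Ioo_left hne hb.bddAbove)
  set E := extendFrom (Ioo α β) g with hEdef
  have hEg : EqOn E g (Ioo α β) := fun t ht =>
    extendFrom_eq (subset_closure ht) (hg t ht)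
  have hEα : E α = sInf (g '' Ioo α β) := eq_lim_at_left_extendFrom_Ioo hαβ
    (hm.monotoneOn.tendsto_nhdsWithin_Ioo_right hne hb.bddBelow)
  have hEβ : E β = sSup (g '' Ioo α β) := eq_lim_at_right_extendFrom_Ioo hαβ
    (hm.monotoneOn.tendsto_nhdsWithin_Ioo_left hne hb.bddAbove)
  have hEm : MonotoneOn E (Icc α β) := by
    have hlo : ∀ t ∈ Ioo α β, E α ≤ E t ∧ E t ≤ E β := fun t ht => by
      rw [hEα, hEβ, hEg ht]
      exact ⟨csInf_le hb.bddBelow (mem_image_of_mem g ht),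
        le_csSup hb.bddAbove (mem_image_of_mem g ht)⟩
    obtain ⟨m, hmm⟩ := hne
    intro s hs t ht hst
    rcases eq_or_lt_of_le hs.1 with rfl | h1
    · rcases eq_or_lt_of_le ht.1 with rfl | h2
      · rfl
      · rcases eq_or_lt_of_le ht.2 with rfl | h3
        · exact (hlo m hmm).1.trans (hlo m hmm).2
        · exact (hlo t ⟨h2, h3⟩).1
    · rcases eq_or_lt_of_le ht.2 with rfl | h3
      · rcases eq_or_lt_of_le hs.2 with rfl | h4
        · rfl
        · exact (hlo s ⟨h1, h4⟩).2
      · have hs' : s ∈ Ioo α β := ⟨h1, hst.trans_lt h3⟩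
        have ht' : t ∈ Ioo α β := ⟨h1.trans_le hst, h3⟩
        rw [hEg hs', hEg ht']
        exact hm.monotoneOn hs' ht' hst
  let C : ℝ → ℝ := fun t => (projIcc α β hαβ.le t : ℝ)
  have hC : Continuous C := continuous_subtype_val.comp continuous_projIcc
  have hCmem : ∀ t, C t ∈ Icc α β := fun t => (projIcc α β hαβ.le t).2
  have hCm : Monotone C := fun s t hst => monotone_projIcc hαβ.le hst
  have hCeq : ∀ t ∈ Icc α β, C t = t := fun t ht => by simp [C, projIcc_of_mem hαβ.le ht]
  have hClip : ∀ s t, s ≤ t → C t - C s ≤ t - s := by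
    intro s t hst
    simp only [C, coe_projIcc]
    grind
  refine ⟨fun t => E (C t) + (t - C t), ?_, ?_, ?_⟩
  · exact (hE.comp_continuous hC hCmem).add (continuous_id.sub hC)
  · intro s t hst
    have h1 := hEm (hCmem s) (hCmem t) (hCm hst.le)
    have h2 := hClip s t hst.le
    rcases lt_or_eq_of_le h2 with h3 | h3
    · simp only; linarith
    · have h4 : C s < C t := by linarith
      have h5 : E (C s) < E (C t) := by
        obtain ⟨u, hu1, hu2⟩ := exists_between h4
        obtain ⟨v, hv1, hv2⟩ := exists_between hu2
        have hu : u ∈ Ioo α β := ⟨(hCmem s).1.trans_lt hu1, hu2.trans_le (hCmem t).2⟩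
        have hv : v ∈ Ioo α β := ⟨hu.1.trans hv1, hv2.trans_le (hCmem t).2⟩
        have h6 := hm hu hv hv1
        rw [← hEg hu, ← hEg hv] at h6
        have h7 := hEm (hCmem s) (Ioo_subset_Icc_self hu) hu1.le
        have h8 := hEm (Ioo_subset_Icc_self hv) (hCmem t) hv2.le
        linarith
      simp only; linarith
  · intro t ht
    have ht' := hCeq t (Ioo_subset_Icc_self ht)
    simp only [ht', hEg ht]; ring

/-- A bounded continuous injection of an open order-connected set of reals extends to a bounded
continuous injection of the whole line. -/
theorem exists_continuous_injective_extension {g : ℝ → ℝ} {S : Set ℝ} (hS : IsOpen S)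
    (hc : S.OrdConnected) (hne : S.Nonempty) (hg : ContinuousOn g S) (hi : InjOn g S)
    (hb : Bornology.IsBounded (g '' S)) :
    ∃ G : ℝ → ℝ, Continuous G ∧ Function.Injective G ∧ Bornology.IsBounded (range G) ∧
      EqOn G g S := by
  have hρ := isOpenEmbedding_lineToIoo (zero_lt_one' ℝ)
  have hρm := lineToIoo_strictMono (zero_lt_one' ℝ)
  have hρr := range_lineToIoo (zero_lt_one' ℝ)
  set ρ := lineToIoo 0 1
  have hT01 : ρ '' S ⊆ Ioo 0 1 := hρr ▸ image_subset_range ρ S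
  have hTc : (ρ '' S).OrdConnected :=
    (isPreconnected_iff_ordConnected.2 hc).image ρ hρ.continuous.continuousOn |>.ordConnected
  obtain ⟨a, b, hab, hT⟩ := eq_Ioo_of_isOpen_ordConnected (hρ.isOpenMap S hS) hTc (hne.image ρ)
    (bddBelow_Ioo.mono hT01) (bddAbove_Ioo.mono hT01)
  let σ : ℝ → ℝ := Function.invFun ρ
  have hσ : ∀ x, σ (ρ x) = x := Function.leftInverse_invFun hρm.injective
  have hσc : ContinuousOn σ (range ρ) := by
    rintro _ ⟨x, rfl⟩
    have : ContinuousAt (σ ∘ ρ) x := by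
      rw [show σ ∘ ρ = id from funext hσ]; exact continuousAt_id
    exact (hρ.continuousAt_iff.1 this).continuousWithinAt
  have hmaps : MapsTo σ (Ioo a b) S := by
    rw [← hT]; rintro _ ⟨x, hx, rfl⟩; rwa [hσ]
  have hgσ : ContinuousOn (g ∘ σ) (Ioo a b) :=
    hg.comp (hσc.mono (hT ▸ image_subset_range ρ S)) hmaps
  have hσi : InjOn σ (Ioo a b) := by
    rw [← hT]; rintro _ ⟨x, hx, rfl⟩ _ ⟨y, hy, rfl⟩ h
    rw [hσ, hσ] at h; rw [h]
  have hgi : InjOn (g ∘ σ) (Ioo a b) := hi.comp hσi hmaps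
  have hgb : Bornology.IsBounded ((g ∘ σ) '' Ioo a b) :=
    hb.subset (by rw [image_comp]; exact image_mono hmaps.image_subset)
  have key : ∃ G : ℝ → ℝ, Continuous G ∧ Function.Injective G ∧ EqOn G (g ∘ σ) (Ioo a b) := by
    rcases hgσ.strictMonoOn_of_injOn_Ioo hab hgi with h | h
    · obtain ⟨G, h1, h2, h3⟩ := exists_continuous_strictMono_extension_Ioo hab hgσ h hgb
      exact ⟨G, h1, h2.injective, h3⟩
    · obtain ⟨G, h1, h2, h3⟩ := exists_continuous_strictMono_extension_Ioo hab hgσ.neg h.neg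
        (hgb.neg.subset (by
          rintro _ ⟨x, hx, rfl⟩; exact ⟨x, hx, by simp⟩))
      refine ⟨fun t => -G t, h1.neg, fun x y hxy => h2.injective (neg_injective hxy),
        fun t ht => ?_⟩
      have := h3 ht
      simp only [Pi.neg_apply] at this
      simp [this]
  obtain ⟨G, hG, hGi, hGe⟩ := key
  refine ⟨G ∘ ρ, hG.comp hρ.continuous, hGi.comp hρm.injective, ?_, fun x hx => ?_⟩
  · refine (isCompact_Icc.image hG : IsCompact (G '' Icc 0 1)).isBounded.subset ?_
    rw [range_comp, hρr]
    exact image_mono Ioo_subset_Icc_self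
  · have := hGe (hT ▸ mem_image_of_mem ρ hx : ρ x ∈ Ioo a b)
    simpa [hσ] using this

end RealLine

section FreeIntervals

variable {X : Type*} [TopologicalSpace X]

theorem Topology.IsOpenEmbedding.continuousOn_invFun {Y : Type*} [TopologicalSpace Y] [Nonempty Y]
    {γ : Y → X} (hγ : IsOpenEmbedding γ) : ContinuousOn (Function.invFun γ) (range γ) := by
  rintro _ ⟨x, rfl⟩
  have : ContinuousAt (Function.invFun γ ∘ γ) x := by
    rw [Function.invFun_comp hγ.injective]; exact continuousAt_id
  exact (hγ.continuousAt_iff.1 this).continuousWithinAt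

theorem nonempty_homeomorph_Ioo_of_isOpenEmbedding {Y : Type*} [TopologicalSpace Y] {ψ : Y → ℝ}
    (hψ : IsOpenEmbedding ψ) {a b : ℝ} (hab : a < b) (hr : range ψ = Ioo a b) :
    Nonempty (Y ≃ₜ ℝ) := by
  have e1 := hψ.toIsEmbedding.toHomeomorph
  have e2 := (isOpenEmbedding_lineToIoo hab).toIsEmbedding.toHomeomorph
  rw [range_lineToIoo hab, ← hr] at e2
  exact ⟨e1.trans e2.symm⟩

theorem isFreeOpenInterval_iff {J : Set X} :
    IsFreeOpenInterval J ↔ ∃ γ : ℝ → X, IsOpenEmbedding γ ∧ range γ = J := by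
  have e := (isOpenEmbedding_lineToIoo (zero_lt_one' ℝ)).toIsEmbedding.toHomeomorph
  rw [range_lineToIoo (zero_lt_one' ℝ)] at e
  constructor
  · rintro ⟨hJ, ⟨h⟩⟩
    refine ⟨Subtype.val ∘ (e.trans h.symm), hJ.isOpenEmbedding_subtypeVal.comp
      (e.trans h.symm).isOpenEmbedding, ?_⟩
    rw [range_comp, (e.trans h.symm).surjective.range_eq, image_univ, Subtype.range_coe]
  · rintro ⟨γ, hγ, rfl⟩
    exact ⟨hγ.isOpen_range, ⟨hγ.toIsEmbedding.toHomeomorph.symm.trans e⟩⟩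

theorem isFreeOpenInterval_image_Ioo {g : ℝ → X} (hg : Continuous g) (ho : IsOpenMap g)
    {a b : ℝ} (hab : a < b) (hi : InjOn g (Ioo a b)) : IsFreeOpenInterval (g '' Ioo a b) := by
  have hρ := isOpenEmbedding_lineToIoo hab
  have hr := range_lineToIoo hab
  refine isFreeOpenInterval_iff.2 ⟨g ∘ lineToIoo a b,
    .of_continuous_injective_isOpenMap (hg.comp hρ.continuous) ?_ (ho.comp hρ.isOpenMap), ?_⟩
  · intro x y hxy
    exact hρ.injective (hi (hr ▸ mem_range_self x) (hr ▸ mem_range_self y) hxy)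
  · rw [range_comp, hr]

/-- An increasing union of free open intervals is a free open interval. -/
theorem isFreeOpenInterval_iUnion {U : ℕ → Set X} (hU : Monotone U)
    (hfree : ∀ n, IsFreeOpenInterval (U n)) : IsFreeOpenInterval (⋃ n, U n) := by
  have hUo : ∀ n, IsOpen (U n) := fun n => (hfree n).1
  choose γ hγ hr using fun n => isFreeOpenInterval_iff.1 (hfree n)
  let P : ℕ → Type _ := fun n =>
    {φ : X → ℝ // ContinuousOn φ (U n) ∧ InjOn φ (U n) ∧ Bornology.IsBounded (φ '' U n)}
  have hcomp : ∀ n (G : ℝ → ℝ), Continuous G → Function.Injective G →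
      Bornology.IsBounded (range G) →
      ContinuousOn (G ∘ Function.invFun (γ n)) (U n) ∧ InjOn (G ∘ Function.invFun (γ n)) (U n) ∧
        Bornology.IsBounded ((G ∘ Function.invFun (γ n)) '' U n) := by
    intro n G hG hGi hGb
    refine ⟨hG.comp_continuousOn (hr n ▸ (hγ n).continuousOn_invFun), ?_,
      hGb.subset ?_⟩
    · rw [← hr n]
      rintro _ ⟨x, rfl⟩ _ ⟨y, rfl⟩ h
      have := hGi h
      rw [Function.leftInverse_invFun (hγ n).injective,
        Function.leftInverse_invFun (hγ n).injective] at this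
      rw [this]
    · rw [image_comp]; exact image_subset_range _ _
  have p0 : P 0 := ⟨lineToIoo 0 1 ∘ Function.invFun (γ 0), hcomp 0 _ (continuous_lineToIoo 0 1)
    (lineToIoo_strictMono one_pos).injective
    (by rw [range_lineToIoo one_pos]; exact isBounded_Ioo 0 1)⟩
  have step : ∀ n (p : P n), ∃ q : P (n + 1), EqOn q.1 p.1 (U n) := by
    intro n p
    have hsub : U n ⊆ range (γ (n + 1)) := hr (n + 1) ▸ hU n.le_succ
    have hpre : IsPreconnected (U n) := hr n ▸ isPreconnected_range (hγ n).continuous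
    have hmaps : MapsTo (γ (n + 1)) (γ (n + 1) ⁻¹' U n) (U n) := fun _ h => h
    obtain ⟨G, hG, hGi, hGb, hGe⟩ := exists_continuous_injective_extension
      (g := p.1 ∘ γ (n + 1)) (S := γ (n + 1) ⁻¹' U n) ((hUo n).preimage (hγ (n + 1)).continuous)
      (hpre.preimage_of_isOpenMap (hγ _).injective (hγ _).isOpenMap hsub).ordConnected
      (by
        obtain ⟨x, hx⟩ : (U n).Nonempty := hr n ▸ range_nonempty _
        obtain ⟨t, rfl⟩ := hsub hx
        exact ⟨t, hx⟩)
      (p.2.1.comp (hγ _).continuous.continuousOn hmaps)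
      (p.2.2.1.comp (hγ _).injective.injOn hmaps)
      (p.2.2.2.subset (by rw [image_comp]; exact image_mono hmaps.image_subset))
    refine ⟨⟨_, hcomp (n + 1) G hG hGi hGb⟩, fun x hx => ?_⟩
    obtain ⟨t, rfl⟩ := hsub hx
    have := hGe hx
    simpa [Function.leftInverse_invFun (hγ (n + 1)).injective t] using this
  choose nxt hnxt using step
  let s : ∀ n, P n := fun n => Nat.rec p0 nxt n
  have hs : ∀ n m, n ≤ m → EqOn (s m).1 (s n).1 (U n) := by
    intro n m hnm
    induction m, hnm using Nat.le_induction with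
    | base => exact fun x _ => rfl
    | succ m hm ih => exact fun x hx => (hnxt m (s m) (hU hm hx)).trans (ih hx)
  classical
  let ψ : X → ℝ := fun x =>
    if h : ∃ n, x ∈ U n then Real.arctan ((s (Nat.find h)).1 x) else 0
  have hψ : ∀ n, ∀ x ∈ U n, ψ x = Real.arctan ((s n).1 x) := by
    intro n x hx
    have h : ∃ n, x ∈ U n := ⟨n, hx⟩
    simp only [ψ, dif_pos h]
    rw [hs _ n (Nat.find_min' h hx) (Nat.find_spec h)]
  have hemb : ∀ n, IsOpenEmbedding (ψ ∘ γ n) := by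
    intro n
    have hm : ∀ t, γ n t ∈ U n := fun t => hr n ▸ mem_range_self t
    have heq : ψ ∘ γ n = fun t => Real.arctan ((s n).1 (γ n t)) := funext fun t => hψ n _ (hm t)
    rw [heq]
    refine isOpenEmbedding_of_continuous_injective (Real.continuous_arctan.comp
      ((s n).2.1.comp_continuous (hγ n).continuous hm)) fun x y hxy => ?_
    exact (hγ n).injective ((s n).2.2.1 (hm x) (hm y) (Real.arctan_injective hxy))
  have hψinj : InjOn ψ (⋃ n, U n) := by
    intro x hx y hy hxy
    obtain ⟨n, hn⟩ := mem_iUnion.1 hx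
    obtain ⟨m, hm⟩ := mem_iUnion.1 hy
    have h1 := hU (le_max_left n m) hn
    have h2 := hU (le_max_right n m) hm
    rw [hψ _ x h1, hψ _ y h2] at hxy
    exact (s _).2.2.1 h1 h2 (Real.arctan_injective hxy)
  have hψo : ∀ V : Set X, IsOpen V → IsOpen (ψ '' (V ∩ ⋃ n, U n)) := by
    intro V hV
    have : ψ '' (V ∩ ⋃ n, U n) = ⋃ n, (ψ ∘ γ n) '' (γ n ⁻¹' V) := by
      rw [inter_iUnion, image_iUnion]
      refine iUnion_congr fun n => ?_
      rw [image_comp, image_preimage_eq_inter_range, hr n]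
    rw [this]
    exact isOpen_iUnion fun n => (hemb n).isOpenMap _ (hV.preimage (hγ n).continuous)
  have hψc : ContinuousOn ψ (⋃ n, U n) := by
    intro x hx
    obtain ⟨n, hn⟩ := mem_iUnion.1 hx
    have h1 : ContinuousOn ψ (U n) :=
      (Real.continuous_arctan.comp_continuousOn (s n).2.1).congr (hψ n)
    exact (h1.continuousAt ((hUo n).mem_nhds hn)).continuousWithinAt
  have hUne : (⋃ n, U n).Nonempty :=
    ⟨γ 0 0, mem_iUnion.2 ⟨0, hr 0 ▸ mem_range_self 0⟩⟩
  have hpre : IsPreconnected (⋃ n, U n) :=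
    IsPreconnected.iUnion_of_chain (fun n => hr n ▸ isPreconnected_range (hγ n).continuous)
      fun n => by
        rw [Nat.succ_eq_succ, inter_eq_left.2 (hU n.le_succ)]
        exact hr n ▸ range_nonempty _
  have hsub : ψ '' (⋃ n, U n) ⊆ Ioo (-(Real.pi / 2)) (Real.pi / 2) := by
    rw [← Real.range_arctan]
    rintro _ ⟨x, hx, rfl⟩
    obtain ⟨n, hn⟩ := mem_iUnion.1 hx
    exact ⟨_, (hψ n x hn).symm⟩
  obtain ⟨a, b, hab, hW⟩ := eq_Ioo_of_isOpen_ordConnected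
    (by simpa using hψo univ isOpen_univ) (hpre.image ψ hψc).ordConnected (hUne.image ψ)
    (bddBelow_Ioo.mono hsub) (bddAbove_Ioo.mono hsub)
  have hres : IsOpenEmbedding ((⋃ n, U n).domRestrict ψ) := by
    refine .of_continuous_injective_isOpenMap (continuousOn_iff_continuous_domRestrict.1 hψc)
      (injOn_iff_injective.1 hψinj) ?_
    intro V hV
    obtain ⟨V', hV', rfl⟩ := isOpen_induced_iff.1 hV
    rw [domRestrict_eq, image_comp, Subtype.image_preimage_coe, inter_comm]
    exact hψo V' hV'
  obtain ⟨e⟩ := nonempty_homeomorph_Ioo_of_isOpenEmbedding hres hab (by rw [range_domRestrict, hW])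
  refine isFreeOpenInterval_iff.2 ⟨Subtype.val ∘ e.symm,
    (isOpen_iUnion hUo).isOpenEmbedding_subtypeVal.comp e.symm.isOpenEmbedding, ?_⟩
  rw [range_comp, e.symm.surjective.range_eq, image_univ, Subtype.range_coe]

theorem IsFreeOpenInterval.nonempty {J : Set X} (hJ : IsFreeOpenInterval J) : J.Nonempty := by
  obtain ⟨γ, -, rfl⟩ := isFreeOpenInterval_iff.1 hJ
  exact range_nonempty γ

theorem IsFreeOpenInterval.exists_isMaxFreeOpenInterval [SecondCountableTopology X] {J : Set X}
    (hJ : IsFreeOpenInterval J) : ∃ K, IsMaxFreeOpenInterval K ∧ J ⊆ K := by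
  obtain ⟨K, hJK, hK⟩ := zorn_subset_nonempty {K : Set X | IsFreeOpenInterval K} (by
    intro c hc hchain hne
    obtain ⟨T, hTc, hTsub, hTU⟩ := TopologicalSpace.isOpen_sUnion_countable c fun s hs => (hc hs).1
    have hTne : T.Nonempty := by
      by_contra h
      rw [not_nonempty_iff_eq_empty] at h
      obtain ⟨s, hs⟩ := hne
      obtain ⟨x, hx⟩ := (hc hs).nonempty
      have : x ∈ ⋃₀ T := hTU ▸ ⟨s, hs, hx⟩
      simp [h] at this
    obtain ⟨s, rfl⟩ := hTc.exists_eq_range hTne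
    have hacc : ∀ n, accumulate s n ∈ c := by
      intro n
      induction n with
      | zero => simpa using hTsub (mem_range_self 0)
      | succ n ih =>
        rw [accumulate_succ]
        rcases hchain.total ih (hTsub (mem_range_self (n + 1))) with h | h
        · rw [union_eq_right.2 h]; exact hTsub (mem_range_self _)
        · rw [union_eq_left.2 h]; exact ih
    refine ⟨⋃ n, accumulate s n,
      isFreeOpenInterval_iUnion monotone_accumulate fun n => hc (hacc n), fun t ht => ?_⟩
    rw [iUnion_accumulate, ← sUnion_range, hTU]
    exact subset_sUnion_of_mem ht) J hJ
  exact ⟨K, ⟨hK.prop, fun L hL hKL => hKL.antisymm (hK.le_of_ge hL hKL)⟩, hJK⟩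

end FreeIntervals

section Ends

variable {X : Type*} [TopologicalSpace X]

/-- The union of all free open intervals. -/
def freePart (X : Type*) [TopologicalSpace X] : Set X := ⋃₀ {J : Set X | IsFreeOpenInterval J}

theorem mem_freePart_iff {x : X} :
    x ∈ freePart X ↔ ∃ δ : ℝ → X, IsOpenEmbedding δ ∧ δ 0 = x := by
  constructor
  · rintro ⟨J, hJ, hx⟩
    obtain ⟨δ, hδ, rfl⟩ := isFreeOpenInterval_iff.1 hJ
    obtain ⟨t, rfl⟩ := hx
    exact ⟨δ ∘ (Homeomorph.addRight t), hδ.comp (Homeomorph.addRight t).isOpenEmbedding, by simp⟩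
  · rintro ⟨δ, hδ, rfl⟩
    exact ⟨range δ, isFreeOpenInterval_iff.2 ⟨δ, hδ, rfl⟩, mem_range_self 0⟩

theorem IsFreeOpenInterval.subset_freePart {J : Set X} (hJ : IsFreeOpenInterval J) :
    J ⊆ freePart X := subset_sUnion_of_mem hJ

theorem isOpenMap_of_forall_mem_freePart {γ : ℝ → X} (hγ : Continuous γ)
    (hi : Function.Injective γ) (hM : ∀ t, γ t ∈ freePart X) : IsOpenMap γ := by
  intro V hV
  rw [isOpen_iff_mem_nhds]
  rintro _ ⟨t, ht, rfl⟩
  obtain ⟨δ, hδ, h0⟩ := mem_freePart_iff.1 (hM t)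
  have hmaps : MapsTo γ (V ∩ γ ⁻¹' range δ) (range δ) := fun _ h => h.2
  have hinv : ∀ s ∈ V ∩ γ ⁻¹' range δ, δ (Function.invFun δ (γ s)) = γ s := fun s hs =>
    Function.invFun_eq hs.2
  have ho : IsOpen ((Function.invFun δ ∘ γ) '' (V ∩ γ ⁻¹' range δ)) :=
    isOpen_image_of_continuousOn_injOn (hV.inter (hδ.isOpen_range.preimage hγ))
      (hδ.continuousOn_invFun.comp hγ.continuousOn hmaps) (by
        intro x hx y hy hxy
        have := congrArg δ hxy
        simp only [Function.comp_apply, hinv x hx, hinv y hy] at this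
        exact hi this)
  refine mem_of_superset ((hδ.isOpenMap _ ho).mem_nhds ?_) ?_
  · exact ⟨_, ⟨t, ⟨ht, 0, h0⟩, rfl⟩, hinv t ⟨ht, 0, h0⟩⟩
  · rintro _ ⟨_, ⟨s, hs, rfl⟩, rfl⟩
    exact ⟨s, hs.1, (hinv s hs).symm⟩

theorem image_Ici_subset_or_image_Iic_subset [T2Space X] {γ : ℝ → X} (hγ : IsOpenEmbedding γ)
    {V : Set X} (hV : IsPreconnected V) {q : X} (hqV : q ∈ V) (hq : q ∉ range γ) {t : ℝ}
    (ht : γ t ∈ V) : γ '' Ici t ⊆ V ∨ γ '' Iic t ⊆ V := by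
  by_contra! h
  simp only [image_subset_iff, not_subset] at h
  obtain ⟨⟨s, hs, hsV⟩, r, hr, hrV⟩ := h
  have hts : t < s := lt_of_le_of_ne hs (by rintro rfl; exact hsV ht)
  have hrt : r < t := lt_of_le_of_ne hr (by rintro rfl; exact hrV ht)
  have hc : IsClosed (γ '' Icc r s) := (isCompact_Icc.image hγ.continuous).isClosed
  rcases hV.subset_or_subset (hγ.isOpenMap _ isOpen_Ioo) hc.isOpen_compl
    (disjoint_compl_right_iff_subset.2 (image_mono Ioo_subset_Icc_self)) (by
      intro x hx
      by_cases hxc : x ∈ γ '' Icc r s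
      · obtain ⟨u, hu, rfl⟩ := hxc
        exact Or.inl ⟨u, ⟨lt_of_le_of_ne hu.1 (by rintro rfl; exact hrV hx),
          lt_of_le_of_ne hu.2 (by rintro rfl; exact hsV hx)⟩, rfl⟩
      · exact Or.inr hxc) with h | h
  · exact hq (image_subset_range _ _ (h hqV))
  · exact h ht ⟨t, ⟨hrt.le, hts.le⟩, rfl⟩

/-- In a locally connected compact space, each end of a free open interval converges. -/
theorem exists_tendsto_atTop [T2Space X] [CompactSpace X] [LocallyConnectedSpace X] {γ : ℝ → X}
    (hγ : IsOpenEmbedding γ) : ∃ q, q ∉ range γ ∧ Tendsto γ atTop (𝓝 q) := by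
  obtain ⟨q, hq⟩ := exists_clusterPt_of_compactSpace (map γ atTop)
  have hfreq : ∀ V ∈ 𝓝 q, ∃ᶠ t in atTop, γ t ∈ V := fun V hV =>
    (mapClusterPt_iff_frequently.1 hq) V hV
  have hqr : q ∉ range γ := by
    rintro ⟨t, rfl⟩
    have hN := (hγ.isOpenMap _ (isOpen_Ioo (a := t - 1) (b := t + 1))).mem_nhds
      ⟨t, ⟨by linarith, by linarith⟩, rfl⟩
    obtain ⟨s, ⟨u, hu, hus⟩, hs⟩ := ((hfreq _ hN).and_eventually (eventually_gt_atTop (t + 1))).exists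
    rw [hγ.injective hus] at hu
    exact lt_asymm hu.2 hs
  refine ⟨q, hqr, fun W hW => ?_⟩
  obtain ⟨V, hVW, hVo, hqV, hVc⟩ := locallyConnectedSpace_iff_subsets_isOpen_isConnected.1 ‹_› q W hW
  have hf := hfreq V (hVo.mem_nhds hqV)
  rw [mem_map]
  change ∀ᶠ t in atTop, γ t ∈ W
  by_cases h : ∃ t, γ '' Ici t ⊆ V
  · obtain ⟨t, ht⟩ := h
    filter_upwards [eventually_ge_atTop t] with s hs
    exact hVW (ht ⟨s, hs, rfl⟩)
  · refine Eventually.of_forall fun u => hVW ?_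
    obtain ⟨t, ht, hut⟩ := (hf.and_eventually (eventually_ge_atTop u)).exists
    rcases image_Ici_subset_or_image_Iic_subset hγ hVc.isPreconnected hqV hqr ht with h1 | h1
    · exact absurd ⟨t, h1⟩ h
    · exact h1 ⟨u, hut, rfl⟩

theorem isOpenEmbedding_comp_neg {γ : ℝ → X} (hγ : IsOpenEmbedding γ) :
    IsOpenEmbedding fun t => γ (-t) := hγ.comp (Homeomorph.neg ℝ).isOpenEmbedding

theorem range_comp_neg {Y : Type*} (γ : ℝ → Y) : range (fun t => γ (-t)) = range γ :=
  (Homeomorph.neg ℝ).surjective.range_comp γ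

theorem exists_tendsto_atBot [T2Space X] [CompactSpace X] [LocallyConnectedSpace X] {γ : ℝ → X}
    (hγ : IsOpenEmbedding γ) : ∃ q, q ∉ range γ ∧ Tendsto γ atBot (𝓝 q) := by
  obtain ⟨q, hq, hq'⟩ := exists_tendsto_atTop (isOpenEmbedding_comp_neg hγ)
  refine ⟨q, range_comp_neg γ ▸ hq, ?_⟩
  simpa [Function.comp_def] using hq'.comp tendsto_neg_atBot_atTop

theorem closure_image_Ici_subset [T2Space X] {γ : ℝ → X} (hγ : Continuous γ) {q : X}
    (hq : Tendsto γ atTop (𝓝 q)) (T : ℝ) : closure (γ '' Ici T) ⊆ γ '' Ici T ∪ {q} := by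
  intro x hx
  by_cases hxq : x = q
  · exact Or.inr hxq
  obtain ⟨N, N', hN, hN', hxN, hqN', hd⟩ := t2_separation hxq
  obtain ⟨b, hb⟩ := eventually_atTop.1 (hq (hN'.mem_nhds hqN'))
  have h1 : x ∈ closure (γ '' Icc T b) := by
    refine closure_mono ?_ (hN.inter_closure ⟨hxN, hx⟩)
    rintro _ ⟨hu, u, huT, rfl⟩
    refine ⟨u, ⟨huT, ?_⟩, rfl⟩
    by_contra hub
    exact disjoint_left.1 hd hu (hb u (not_le.1 hub).le)
  rw [(isCompact_Icc.image hγ).isClosed.closure_eq] at h1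
  exact Or.inl (image_mono Icc_subset_Ici_self h1)

theorem closure_image_Iic_subset [T2Space X] {γ : ℝ → X} (hγ : Continuous γ) {q : X}
    (hq : Tendsto γ atBot (𝓝 q)) (T : ℝ) : closure (γ '' Iic T) ⊆ γ '' Iic T ∪ {q} := by
  have h := closure_image_Ici_subset (hγ.comp continuous_neg) (hq.comp tendsto_neg_atTop_atBot) (-T)
  have : (γ ∘ Neg.neg) '' Ici (-T) = γ '' Iic T := by
    rw [image_comp]; simp
  rwa [this] at h

theorem closure_range_subset [T2Space X] {γ : ℝ → X} (hγ : Continuous γ) {p q : X}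
    (hp : Tendsto γ atBot (𝓝 p)) (hq : Tendsto γ atTop (𝓝 q)) :
    closure (range γ) ⊆ range γ ∪ {p, q} := by
  have : range γ = γ '' Iic 0 ∪ γ '' Ici 0 := by
    rw [← image_union, Iic_union_Ici, image_univ]
  rw [this, closure_union]
  rintro x (hx | hx)
  · rcases closure_image_Iic_subset hγ hp 0 hx with h | h
    · exact Or.inl (Or.inl h)
    · exact Or.inr (Or.inl h)
  · rcases closure_image_Ici_subset hγ hq 0 hx with h | h
    · exact Or.inl (Or.inr h)
    · exact Or.inr (Or.inr h)

theorem image_Ici_eq_of_tendsto_zero_of_neg {g : ℝ → ℝ} {T : ℝ} (hg : ContinuousOn g (Ici T))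
    (hi : InjOn g (Ici T)) (h0 : Tendsto g atTop (𝓝 0)) (hneg : ∀ t ≥ T, g t < 0) :
    g '' Ici T = Ico (g T) 0 := by
  have key : ∀ t ≥ T, ∀ u, g t ≤ u → u < 0 → ∃ s ≥ t, g s = u := by
    intro t ht u hu hu0
    obtain ⟨b, hb, hbt⟩ := ((h0.eventually_const_lt hu0).and (eventually_ge_atTop t)).exists
    obtain ⟨s, hs, hsu⟩ := intermediate_value_Icc hbt
      (hg.mono (Icc_subset_Ici_self.trans (Ici_subset_Ici.2 ht))) ⟨hu, hb.le⟩
    exact ⟨s, hs.1, hsu⟩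
  refine Subset.antisymm ?_ ?_
  · rintro _ ⟨t, ht, rfl⟩
    refine ⟨?_, hneg t ht⟩
    by_contra! hlt
    obtain ⟨s, hs, hsu⟩ := key t ht (g T) hlt.le (hneg T le_rfl)
    have hsT : s = T := hi (le_trans (mem_Ici.1 ht) hs : T ≤ s) self_mem_Ici hsu
    have : t = T := le_antisymm (hsT ▸ hs) ht
    rw [this] at hlt
    exact lt_irrefl _ hlt
  · rintro u ⟨h1, h2⟩
    exact key T le_rfl u h1 h2

/-- An end of a free open interval converging to a point with a chart fills one side of it. -/
theorem exists_collar {γ δ : ℝ → X} (hγ : IsOpenEmbedding γ) (hδ : IsOpenEmbedding δ)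
    (h0 : δ 0 ∉ range γ) (ht : Tendsto γ atTop (𝓝 (δ 0))) : ∃ T τ, δ τ = γ T ∧
      (τ < 0 ∧ δ '' Ico τ 0 = γ '' Ici T ∨ 0 < τ ∧ δ '' Ioc 0 τ = γ '' Ici T) := by
  obtain ⟨T, hT⟩ := eventually_atTop.1 (ht (hδ.isOpen_range.mem_nhds (mem_range_self 0)))
  set g : ℝ → ℝ := Function.invFun δ ∘ γ with hgdef
  have hinv : ∀ t ≥ T, δ (g t) = γ t := fun t ht => Function.invFun_eq (hT t ht)
  have hg : ContinuousOn g (Ici T) :=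
    hδ.continuousOn_invFun.comp hγ.continuous.continuousOn fun t ht => hT t ht
  have hi : InjOn g (Ici T) := by
    intro s hs t ht hst
    have := congrArg δ hst
    rw [hinv s hs, hinv t ht] at this
    exact hγ.injective this
  have hg0 : Tendsto g atTop (𝓝 0) := by
    have h1 : ContinuousAt (Function.invFun δ) (δ 0) :=
      hδ.continuousOn_invFun.continuousAt (hδ.isOpen_range.mem_nhds (mem_range_self 0))
    have h2 : Function.invFun δ (δ 0) = 0 := Function.leftInverse_invFun hδ.injective 0
    rw [ContinuousAt, h2] at h1
    exact h1.comp ht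
  have hne : ∀ t ≥ T, g t ≠ 0 := by
    intro t ht h
    exact h0 ⟨t, by rw [← hinv t ht, h]⟩
  have himg : ∀ S, g '' Ici T = S → δ '' S = γ '' Ici T := by
    rintro _ rfl
    rw [← image_comp]
    exact image_congr fun t ht => hinv t ht
  refine ⟨T, g T, hinv T le_rfl, ?_⟩
  have hpc : IsPreconnected (g '' Ici T) := isPreconnected_Ici.image g hg
  rcases hpc.subset_or_subset isOpen_Iio isOpen_Ioi
    (disjoint_left.2 fun x (h1 : x < 0) (h2 : 0 < x) => lt_asymm h1 h2) (by
      rintro _ ⟨t, ht, rfl⟩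
      exact lt_or_gt_of_ne (hne t ht)) with h | h
  · exact Or.inl ⟨h ⟨T, self_mem_Ici, rfl⟩, himg _ <|
      image_Ici_eq_of_tendsto_zero_of_neg hg hi hg0 fun t ht => h ⟨t, ht, rfl⟩⟩
  · refine Or.inr ⟨h ⟨T, self_mem_Ici, rfl⟩, himg _ ?_⟩
    have := image_Ici_eq_of_tendsto_zero_of_neg (g := fun t => -g t) hg.neg
      (fun s hs t ht hst => hi hs ht (neg_injective hst)) (by simpa using hg0.neg)
      fun t ht => neg_lt_zero.2 (h ⟨t, ht, rfl⟩)
    have h3 := congrArg (Neg.neg '' ·) this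
    simpa [← image_comp, Function.comp_def] using h3

end Ends

section MaximalIntervals

variable {X : Type*} [TopologicalSpace X]

theorem spaceIsCircle_of_range_eq_compl_singleton [T2Space X] [CompactSpace X] {γ : ℝ → X}
    (hγ : IsOpenEmbedding γ) {q : X} (h : range γ = {q}ᶜ) : SpaceIsCircle X := by
  have e1 : OnePoint ℝ ≃ₜ X := OnePoint.equivOfIsEmbeddingOfRangeEq q γ hγ.isEmbedding h
  have e2 : OnePoint ℝ ≃ₜ sphere (0 : EuclideanSpace ℝ (Fin 2)) 1 :=
    onePointEquivSphereOfFinrankEq (ι := Fin 2) (V := ℝ) (by simp)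
  have e3 : sphere (0 : ℂ) 1 ≃ₜ sphere (0 : EuclideanSpace ℝ (Fin 2)) 1 :=
    Complex.orthonormalBasisOneI.repr.toHomeomorph.sets (by
      ext x; simp)
  exact ⟨(e1.symm.trans e2).trans e3.symm⟩

/-- A free open interval can be continued along a chart at one of its ends. -/
theorem exists_extension_of_collar {γ δ : ℝ → X} (hγ : IsOpenEmbedding γ) (hδ : IsOpenEmbedding δ)
    {T τ : ℝ} (hτ : δ τ = γ T) (hτ0 : τ < 0) (hcol : δ '' Ico τ 0 = γ '' Ici T)
    (hout : ∀ u ≥ 0, δ u ∉ range γ) :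
    ∃ γ' : ℝ → X, IsOpenEmbedding γ' ∧ range γ ⊆ range γ' ∧ δ 0 ∈ range γ' := by
  set γ' : ℝ → X := fun t => if t ≤ τ then γ (t + (T - τ)) else δ t with hγ'
  have hle : ∀ t ≤ τ, γ' t = γ (t + (T - τ)) := fun t ht => if_pos ht
  have hgt : ∀ t, τ < t → γ' t = δ t := fun t ht => if_neg (not_le.2 ht)
  have hcont : Continuous γ' := by
    refine Continuous.if_le (hγ.continuous.comp (by fun_prop)) hδ.continuous continuous_id
      continuous_const ?_
    rintro t rfl
    simp [hτ]
  have hcross : ∀ s t, s ≤ τ → τ < t → γ' s ≠ γ' t := by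
    intro s t hs ht h
    rw [hle s hs, hgt t ht] at h
    rcases le_or_gt 0 t with h0 | h0
    · exact hout t h0 ⟨_, h⟩
    · obtain ⟨u, hu, hut⟩ : δ t ∈ γ '' Ici T := hcol ▸ ⟨t, ⟨ht.le, h0⟩, rfl⟩
      have hu' : u = s + (T - τ) := hγ.injective (hut.trans h.symm)
      have : u = T := le_antisymm (by linarith) hu
      rw [this, ← hτ] at hut
      exact ht.ne (hδ.injective hut)
  have hinj : Function.Injective γ' := by
    intro s t h
    rcases le_or_gt s τ with hs | hs <;> rcases le_or_gt t τ with ht | ht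
    · rw [hle s hs, hle t ht] at h
      linarith [hγ.injective h]
    · exact absurd h (hcross s t hs ht)
    · exact absurd h.symm (hcross t s ht hs)
    · rw [hgt s hs, hgt t ht] at h
      exact hδ.injective h
  have hM : ∀ t, γ' t ∈ freePart X := by
    intro t
    rcases le_or_gt t τ with ht | ht
    · rw [hle t ht]
      exact (isFreeOpenInterval_iff.2 ⟨γ, hγ, rfl⟩).subset_freePart (mem_range_self _)
    · rw [hgt t ht]
      exact (isFreeOpenInterval_iff.2 ⟨δ, hδ, rfl⟩).subset_freePart (mem_range_self _)
  refine ⟨γ', .of_continuous_injective_isOpenMap hcont hinj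
    (isOpenMap_of_forall_mem_freePart hcont hinj hM), ?_, ⟨0, hgt 0 hτ0⟩⟩
  rintro _ ⟨r, rfl⟩
  rcases le_or_gt r T with hr | hr
  · refine ⟨r - (T - τ), ?_⟩
    rw [hle _ (by linarith)]
    congr 1; ring
  · obtain ⟨u, hu, hur⟩ : γ r ∈ δ '' Ico τ 0 := hcol ▸ ⟨r, hr.le, rfl⟩
    have hne : u ≠ τ := by
      rintro rfl
      exact hr.ne (hγ.injective (hτ.symm.trans hur))
    exact ⟨u, (hgt u (lt_of_le_of_ne hu.1 hne.symm)).trans hur⟩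

variable [T2Space X]

theorem tendsto_atBot_of_collar {γ δ : ℝ → X} (hγ : IsOpenEmbedding γ) (hδ : IsOpenEmbedding δ)
    {p : X} (hp : Tendsto γ atBot (𝓝 p)) (h0 : δ 0 ∉ range γ) {T τ : ℝ}
    (hcol : δ '' Ico τ 0 = γ '' Ici T) (hacc : ∀ ε > 0, ∃ u ∈ Ioo 0 ε, δ u ∈ range γ) :
    p = δ 0 := by
  by_contra hne
  have hmem : δ 0 ∈ (closure (γ '' Iic T))ᶜ := fun h =>
    (closure_image_Iic_subset hγ.continuous hp T h).elim
      (fun h => h0 (image_subset_range _ _ h)) fun h => hne h.symm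
  obtain ⟨ε, hε, hsub⟩ := Metric.isOpen_iff.1
    (isClosed_closure.isOpen_compl.preimage hδ.continuous) 0 hmem
  obtain ⟨u, hu, r, hr⟩ := hacc ε hε
  have hub : u ∈ ball (0 : ℝ) ε := by
    rw [Real.ball_eq_Ioo]; exact ⟨by linarith [hu.1], by linarith [hu.2]⟩
  have h1 := hsub hub
  have hrT : T ≤ r := by
    by_contra! h
    exact h1 (subset_closure ⟨r, h.le, hr⟩)
  obtain ⟨v, hv, hvr⟩ : γ r ∈ δ '' Ico τ 0 := hcol ▸ ⟨r, hrT, rfl⟩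
  have := hδ.injective (hvr.trans hr)
  linarith [hv.2, hu.1]

theorem spaceIsCircle_of_collars [CompactSpace X] [ConnectedSpace X] {γ δ : ℝ → X}
    (hγ : IsOpenEmbedding γ) (hδ : IsOpenEmbedding δ) (hq : Tendsto γ atTop (𝓝 (δ 0)))
    (hp : Tendsto γ atBot (𝓝 (δ 0))) (h0 : δ 0 ∉ range γ) {T τ : ℝ} (hτ : τ < 0)
    (hcol : δ '' Ico τ 0 = γ '' Ici T) : SpaceIsCircle X := by
  obtain ⟨T', τ', -, h | h⟩ := exists_collar (isOpenEmbedding_comp_neg hγ) hδ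
    (by rwa [range_comp_neg]) (by simpa [Function.comp_def] using hp.comp tendsto_neg_atTop_atBot)
  · exfalso
    obtain ⟨hτ', hcol'⟩ := h
    have hsub : δ '' Ioo (max τ τ') 0 ⊆ γ '' Icc T (-T') := by
      rintro _ ⟨u, hu, rfl⟩
      have hu1 := max_lt_iff.1 hu.1
      obtain ⟨s, hs, hsu⟩ : δ u ∈ γ '' Ici T := hcol ▸ ⟨u, ⟨hu1.1.le, hu.2⟩, rfl⟩
      obtain ⟨s', hs', hsu'⟩ : δ u ∈ (fun t => γ (-t)) '' Ici T' :=
        hcol' ▸ ⟨u, ⟨hu1.2.le, hu.2⟩, rfl⟩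
      have : s = -s' := hγ.injective (hsu.trans hsu'.symm)
      exact ⟨s, ⟨hs, by linarith [mem_Ici.1 hs']⟩, hsu⟩
    have hcl : δ 0 ∈ closure (δ '' Ioo (max τ τ') 0) :=
      image_closure_subset_closure_image hδ.continuous ⟨0, by
        rw [closure_Ioo (max_lt hτ hτ').ne]; exact ⟨(max_lt hτ hτ').le, le_rfl⟩, rfl⟩
    have := closure_minimal hsub (isCompact_Icc.image hγ.continuous).isClosed hcl
    exact h0 (image_subset_range _ _ this)
  · obtain ⟨hτ', hcol'⟩ := h
    set S : Set X := range γ ∪ {δ 0} with hS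
    have hclosed : IsClosed S := by
      refine isClosed_of_closure_subset ?_
      rw [closure_union, closure_singleton]
      refine union_subset ((closure_range_subset hγ.continuous hp hq).trans ?_) subset_union_right
      simp [hS]
    have hSeq : S = range γ ∪ δ '' Ioo τ τ' := by
      refine Subset.antisymm (union_subset subset_union_left ?_)
        (union_subset subset_union_left ?_)
      · rintro _ rfl
        exact Or.inr ⟨0, ⟨hτ, hτ'⟩, rfl⟩
      · rintro _ ⟨u, hu, rfl⟩
        rcases lt_trichotomy u 0 with hlt | rfl | hgt
        · have : δ u ∈ γ '' Ici T := hcol ▸ ⟨u, ⟨hu.1.le, hlt⟩, rfl⟩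
          exact Or.inl (image_subset_range _ _ this)
        · exact Or.inr rfl
        · have : δ u ∈ (fun t => γ (-t)) '' Ici T' := hcol' ▸ ⟨u, ⟨hgt, hu.2.le⟩, rfl⟩
          rw [hS, ← range_comp_neg γ]
          exact Or.inl (image_subset_range _ _ this)
    have hopen : IsOpen S := by
      rw [hSeq]
      exact hγ.isOpen_range.union (hδ.isOpenMap _ isOpen_Ioo)
    have huniv := IsClopen.eq_univ ⟨hclosed, hopen⟩ ⟨δ 0, Or.inr rfl⟩
    refine spaceIsCircle_of_range_eq_compl_singleton hγ (q := δ 0) ?_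
    refine Subset.antisymm (fun x hx hxq => h0 (hxq ▸ hx)) fun x hx => ?_
    exact (huniv ▸ mem_univ x : x ∈ S).resolve_right hx

variable [CompactSpace X] [ConnectedSpace X] [LocallyConnectedSpace X]

/-- The ends of a maximal free open interval have no neighborhood that is an open interval. -/
theorem IsMaxFreeOpenInterval.notMem_freePart_of_tendsto_atTop (hcirc : ¬ SpaceIsCircle X)
    {γ : ℝ → X} (hγ : IsOpenEmbedding γ) (hmax : IsMaxFreeOpenInterval (range γ)) {q : X}
    (hqr : q ∉ range γ) (hq : Tendsto γ atTop (𝓝 q)) : q ∉ freePart X := by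
  intro hqM
  obtain ⟨δ, hδ, rfl, T, τ, hτ, hτ0, hcol⟩ : ∃ δ : ℝ → X, IsOpenEmbedding δ ∧ δ 0 = q ∧
      ∃ T τ, δ τ = γ T ∧ τ < 0 ∧ δ '' Ico τ 0 = γ '' Ici T := by
    obtain ⟨δ, hδ, rfl⟩ := mem_freePart_iff.1 hqM
    obtain ⟨T, τ, hτ, h | h⟩ := exists_collar hγ hδ hqr hq
    · exact ⟨δ, hδ, rfl, T, τ, hτ, h⟩
    · refine ⟨_, isOpenEmbedding_comp_neg hδ, by simp, T, -τ, by simpa using hτ,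
        by simpa using h.1, ?_⟩
      rw [← h.2, show (fun t => δ (-t)) = δ ∘ Neg.neg from rfl, image_comp]
      simp
  by_cases hacc : ∀ ε > 0, ∃ u ∈ Ioo 0 ε, δ u ∈ range γ
  · obtain ⟨p, -, hp⟩ := exists_tendsto_atBot hγ
    obtain rfl := tendsto_atBot_of_collar hγ hδ hp hqr hcol hacc
    exact hcirc (spaceIsCircle_of_collars hγ hδ hq hp hqr hτ0 hcol)
  · push Not at hacc
    obtain ⟨ε, hε, hout⟩ := hacc
    have hρ := isOpenEmbedding_lineToIoo (show -ε < ε by linarith)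
    have hρm := lineToIoo_strictMono (show -ε < ε by linarith)
    have hρ0 : lineToIoo (-ε) ε 0 = 0 := by simp [lineToIoo]
    have hpos : ∀ u > 0, δ (lineToIoo (-ε) ε u) ∉ range γ := fun u hu => hout _
      ⟨hρ0 ▸ hρm hu, (range_lineToIoo (show -ε < ε by linarith) ▸ mem_range_self u :
        lineToIoo (-ε) ε u ∈ Ioo (-ε) ε).2⟩
    have hδ' : IsOpenEmbedding fun t => δ (lineToIoo (-ε) ε t) := hδ.comp hρ
    obtain ⟨T', τ', hτ', h | h⟩ := exists_collar hγ hδ' (by rwa [hρ0]) (by rwa [hρ0])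
    · obtain ⟨γ', hγ', hsub, h0⟩ := exists_extension_of_collar hγ hδ' hτ' h.1 h.2 (by
        intro u hu
        rcases hu.eq_or_lt with rfl | hu
        · rwa [hρ0]
        · exact hpos u hu)
      rw [hρ0] at h0
      exact hqr (hmax.2 _ (isFreeOpenInterval_iff.2 ⟨γ', hγ', rfl⟩) hsub ▸ h0)
    · exact hpos τ' h.1 ⟨_, hτ'.symm⟩

/-- The closure of a maximal free open interval adds its two (possibly equal) ends, neither of which
lies in a free open interval. -/
theorem IsMaxFreeOpenInterval.exists_ends (hcirc : ¬ SpaceIsCircle X) {γ : ℝ → X}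
    (hγ : IsOpenEmbedding γ) (hmax : IsMaxFreeOpenInterval (range γ)) :
    ∃ p q, p ∉ freePart X ∧ q ∉ freePart X ∧ Tendsto γ atBot (𝓝 p) ∧ Tendsto γ atTop (𝓝 q) ∧
      closure (range γ) = range γ ∪ {p, q} := by
  obtain ⟨p, hpr, hp⟩ := exists_tendsto_atBot hγ
  obtain ⟨q, hqr, hq⟩ := exists_tendsto_atTop hγ
  have hγ' := isOpenEmbedding_comp_neg hγ
  refine ⟨p, q, ?_, hmax.notMem_freePart_of_tendsto_atTop hcirc hγ hqr hq, hp, hq, ?_⟩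
  · refine IsMaxFreeOpenInterval.notMem_freePart_of_tendsto_atTop hcirc hγ' ?_ ?_ (hp.comp
      tendsto_neg_atTop_atBot)
    · rwa [range_comp_neg]
    · rwa [range_comp_neg]
  · refine Subset.antisymm (closure_range_subset hγ.continuous hp hq) (union_subset subset_closure ?_)
    rintro x (rfl | rfl)
    · exact mem_closure_of_tendsto hp (Eventually.of_forall mem_range_self)
    · exact mem_closure_of_tendsto hq (Eventually.of_forall mem_range_self)

theorem IsMaxFreeOpenInterval.subset_of_isPreconnected (hcirc : ¬ SpaceIsCircle X) {K S : Set X}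
    (hK : IsMaxFreeOpenInterval K) (hS : IsPreconnected S) (hSM : S ⊆ freePart X)
    (hne : (S ∩ K).Nonempty) : S ⊆ K := by
  obtain ⟨γ, hγ, rfl⟩ := isFreeOpenInterval_iff.1 hK.1
  obtain ⟨p, q, hp, hq, -, -, hcl⟩ := hK.exists_ends hcirc hγ
  rcases hS.subset_or_subset hγ.isOpen_range isClosed_closure.isOpen_compl
    (disjoint_compl_right_iff_subset.2 subset_closure) (by
      intro x hx
      by_cases h : x ∈ closure (range γ)
      · rw [hcl] at h
        rcases h with h | rfl | rfl
        · exact Or.inl h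
        · exact absurd (hSM hx) hp
        · exact absurd (hSM hx) hq
      · exact Or.inr h) with h | h
  · exact h
  · obtain ⟨x, hx, hxK⟩ := hne
    exact absurd (subset_closure hxK) (h hx)

theorem IsFreeOpenInterval.isPreconnected {X : Type*} [TopologicalSpace X] {K : Set X}
    (hK : IsFreeOpenInterval K) : IsPreconnected K := by
  obtain ⟨γ, hγ, rfl⟩ := isFreeOpenInterval_iff.1 hK
  exact isPreconnected_range hγ.continuous

theorem IsMaxFreeOpenInterval.eq_of_nonempty_inter (hcirc : ¬ SpaceIsCircle X) {K K' : Set X}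
    (hK : IsMaxFreeOpenInterval K) (hK' : IsMaxFreeOpenInterval K') (hne : (K ∩ K').Nonempty) :
    K = K' :=
  (hK'.subset_of_isPreconnected hcirc hK.1.isPreconnected hK.1.subset_freePart hne).antisymm
    (hK.subset_of_isPreconnected hcirc hK'.1.isPreconnected hK'.1.subset_freePart
      (by rwa [inter_comm]))

end MaximalIntervals

section Finiteness

variable {X : Type*} [MetricSpace X] [CompactSpace X] [ConnectedSpace X] [LocallyConnectedSpace X]

theorem diam_le_of_forall_not_subset (hcirc : ¬ SpaceIsCircle X) {K : Set X}
    (hK : IsMaxFreeOpenInterval K) {r : ℝ} (hr : 0 ≤ r)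
    (h : ∀ y ∈ K, ∃ V, IsPreconnected V ∧ y ∈ V ∧ (∀ z ∈ V, dist y z ≤ r) ∧ ¬ V ⊆ K) :
    diam K ≤ 4 * r := by
  obtain ⟨γ, hγ, rfl⟩ := isFreeOpenInterval_iff.1 hK.1
  obtain ⟨p, q, hp, hq, -, -, hcl⟩ := hK.exists_ends hcirc hγ
  have hnear : ∀ y ∈ range γ, dist y p ≤ r ∨ dist y q ≤ r := by
    intro y hy
    obtain ⟨V, hV, hyV, hVr, hVK⟩ := h y hy
    by_contra! hfar
    rcases hV.subset_or_subset hγ.isOpen_range isClosed_closure.isOpen_compl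
      (disjoint_compl_right_iff_subset.2 subset_closure) (by
        intro x hx
        by_cases h : x ∈ closure (range γ)
        · rw [hcl] at h
          rcases h with h | rfl | rfl
          · exact Or.inl h
          · exact absurd (hVr _ hx) (not_le.2 hfar.1)
          · exact absurd (hVr _ hx) (not_le.2 hfar.2)
        · exact Or.inr h) with h | h
    · exact hVK h
    · exact h hyV (subset_closure hy)
  refine diam_le_of_forall_dist_le (by positivity) fun x hx y hy => ?_
  by_cases hmeet : (range γ ∩ (closedBall p r ∩ closedBall q r)).Nonempty
  · obtain ⟨z, -, hzp, hzq⟩ := hmeet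
    rw [mem_closedBall] at hzp hzq
    rcases hnear x hx with h1 | h1 <;> rcases hnear y hy with h2 | h2
    · linarith [dist_triangle_right x y p]
    · linarith [dist_triangle4_right x y p q, dist_triangle_left p q z]
    · linarith [dist_triangle4_right x y q p, dist_triangle_left q p z]
    · linarith [dist_triangle_right x y q]
  · have hcover : range γ ⊆ closedBall p r ∪ closedBall q r := hnear
    rcases isPreconnected_iff_subset_of_disjoint_closed.1 hK.1.isPreconnected _ _
      isClosed_closedBall isClosed_closedBall hcover (not_nonempty_iff_eq_empty.1 hmeet) with h1 | h1
    · linarith [dist_triangle_right x y p, mem_closedBall.1 (h1 hx), mem_closedBall.1 (h1 hy)]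
    · linarith [dist_triangle_right x y q, mem_closedBall.1 (h1 hx), mem_closedBall.1 (h1 hy)]

theorem finite_setOf_lt_diam (hcirc : ¬ SpaceIsCircle X) {c : ℝ} (hc : 0 < c) :
    {K : Set X | IsMaxFreeOpenInterval K ∧ c < diam K}.Finite := by
  have hloc : ∀ x : X, ∃ V ⊆ ball x (c / 8), IsOpen V ∧ x ∈ V ∧ IsConnected V := fun x =>
    locallyConnectedSpace_iff_subsets_isOpen_isConnected.1 ‹_› x _ (ball_mem_nhds x (by positivity))
  choose V hVs hVo hxV hVc using hloc
  obtain ⟨t, ht⟩ := isCompact_univ.elim_finite_subcover V hVo fun x _ => mem_iUnion.2 ⟨x, hxV x⟩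
  have hex : ∀ K ∈ {K : Set X | IsMaxFreeOpenInterval K ∧ c < diam K}, ∃ x ∈ t, V x ⊆ K := by
    rintro K ⟨hK, hcK⟩
    by_contra! hno
    refine absurd (diam_le_of_forall_not_subset hcirc hK (r := c / 4) (by positivity) ?_)
      (by linarith)
    intro y _
    obtain ⟨x, hx, hyx⟩ := mem_iUnion₂.1 (ht (mem_univ y))
    refine ⟨V x, (hVc x).isPreconnected, hyx, fun z hz => ?_, hno x hx⟩
    linarith [dist_triangle_right y z x, mem_ball.1 (hVs x hyx), mem_ball.1 (hVs x hz)]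
  choose! i hit hi using hex
  refine Set.Finite.of_injOn (f := i) (t := t) hit ?_ t.finite_toSet
  intro K hK K' hK' h
  exact hK.1.eq_of_nonempty_inter hcirc hK'.1 ⟨i K, hi K hK (hxV _), h ▸ hi K' hK' (hxV _)⟩

end Finiteness

section Folding

variable {X : Type*} [TopologicalSpace X] [T2Space X] [ConnectedSpace X] {g : ℝ → X} {a b : ℝ} {y : X}

theorem not_endpoints_mem_image_Ioo (hg : Continuous g) (ho : IsOpenMap g)
    (hy : y ∉ g '' Ioo a b) {s t : ℝ} (has : a < s) (hst : s < t) (htb : t < b)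
    (h1 : g s ∈ g '' Ioo s t) (h2 : g t ∈ g '' Ioo s t) : False := by
  have heq : g '' Ioo s t = g '' Icc s t := by
    refine Subset.antisymm (image_mono Ioo_subset_Icc_self) ?_
    rintro _ ⟨u, hu, rfl⟩
    rcases hu.1.eq_or_lt with rfl | h3
    · exact h1
    rcases hu.2.eq_or_lt with rfl | h4
    · exact h2
    exact ⟨u, ⟨h3, h4⟩, rfl⟩
  have hclopen : IsClopen (g '' Ioo s t) :=
    ⟨heq ▸ (isCompact_Icc.image hg).isClosed, ho _ isOpen_Ioo⟩
  have huniv := hclopen.eq_univ ⟨_, h1⟩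
  exact hy (image_mono (Ioo_subset_Ioo has.le htb.le) (huniv ▸ mem_univ y))

theorem not_eq_three (hg : Continuous g) (ho : IsOpenMap g) (hy : y ∉ g '' Ioo a b) {s r t : ℝ}
    (has : a < s) (hsr : s < r) (hrt : r < t) (htb : t < b) (h1 : g s = g r) (h2 : g t = g r) :
    False :=
  not_endpoints_mem_image_Ioo hg ho hy has (hsr.trans hrt) htb ⟨r, ⟨hsr, hrt⟩, h1.symm⟩
    ⟨r, ⟨hsr, hrt⟩, h2.symm⟩

theorem not_linked (hg : Continuous g) (ho : IsOpenMap g) (hy : y ∉ g '' Ioo a b) {s s' t t' : ℝ}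
    (has : a < s) (hss' : s < s') (hst : s' < t) (htt' : t < t') (htb : t' < b) (h1 : g s = g t)
    (h2 : g s' = g t') : False :=
  not_endpoints_mem_image_Ioo hg ho hy has (hss'.trans (hst.trans htt')) htb
    ⟨t, ⟨hss'.trans hst, htt'⟩, h1.symm⟩ ⟨s', ⟨hss', hst.trans htt'⟩, h2⟩

theorem exists_partners_right (hg : Continuous g) (ho : IsOpenMap g) (hy : y ∉ g '' Ioo a b)
    {p q : ℝ} (hap : a < p) (hpq : p < q) (hqb : q < b) (h : g p = g q) :
    ∃ ε > 0, p + ε < q ∧ ∀ v ∈ Ioc p (p + ε), ∃ w ∈ Ico (p + ε) q, g w = g v := by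
  set η := min ((q - p) / 2) (b - q) with hη
  have hη0 : 0 < η := lt_min (by linarith) (by linarith)
  have hη1 : η ≤ (q - p) / 2 := min_le_left _ _
  have hη2 : η ≤ b - q := min_le_right _ _
  have hN : g ⁻¹' (g '' Ioo (q - η) (q + η)) ∈ 𝓝 p := by
    refine hg.continuousAt.preimage_mem_nhds ((ho _ isOpen_Ioo).mem_nhds ?_)
    exact ⟨q, ⟨by linarith, by linarith⟩, h.symm⟩
  obtain ⟨ε', hε', hsub⟩ := Metric.mem_nhds_iff.1 hN
  refine ⟨min (ε' / 2) (η / 2), lt_min (by linarith) (by linarith), ?_, ?_⟩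
  · linarith [min_le_right (ε' / 2) (η / 2)]
  intro v hv
  have hvε : v ≤ p + ε' / 2 := hv.2.trans (by linarith [min_le_left (ε' / 2) (η / 2)])
  have hvη : v ≤ p + η / 2 := hv.2.trans (by linarith [min_le_right (ε' / 2) (η / 2)])
  have hvb : v ∈ ball p ε' := by
    rw [Real.ball_eq_Ioo]; exact ⟨by linarith [hv.1], by linarith⟩
  obtain ⟨w, hw, hwv⟩ := hsub hvb
  refine ⟨w, ⟨by linarith [hw.1, min_le_right (ε' / 2) (η / 2)], ?_⟩, hwv⟩
  by_contra! hqw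
  rcases hqw.eq_or_lt with rfl | hqw
  · exact not_eq_three hg ho hy hap hv.1 (by linarith) hqb (h.trans hwv) hwv
  · exact not_linked hg ho hy hap hv.1 (by linarith) hqw (by linarith [hw.2]) h hwv.symm

/-- A continuous open map of the line that misses a point and identifies two points folds the line:
some half-open interval is mapped injectively onto an open set. -/
theorem exists_fold (hg : Continuous g) (ho : IsOpenMap g) (hy : y ∉ g '' Ioo a b)
    (hinj : ¬ InjOn g (Ioo a b)) : ∃ s p, s < p ∧ InjOn g (Icc s p) ∧ IsOpen (g '' Ioc s p) := by
  obtain ⟨s, t, has, hst, htb, hgst⟩ : ∃ s t, a < s ∧ s < t ∧ t < b ∧ g s = g t := by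
    simp only [InjOn, not_forall] at hinj
    obtain ⟨s, hs, t, ht, h, hne⟩ := hinj
    rcases lt_or_gt_of_ne hne with hlt | hlt
    · exact ⟨s, t, hs.1, hlt, ht.2, h⟩
    · exact ⟨t, s, ht.1, hlt, hs.2, h.symm⟩
  set G : Set ℝ := {x | x ∈ Icc s t ∧ ∀ a' ∈ Icc s x, ∃ b' ∈ Icc x t, g b' = g a'} with hG
  have hsG : s ∈ G := by
    refine ⟨⟨le_rfl, hst.le⟩, fun a' ha' => ⟨t, ⟨hst.le, le_rfl⟩, ?_⟩⟩
    rw [le_antisymm ha'.2 ha'.1, hgst]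
  have hbdd : BddAbove G := ⟨t, fun x hx => hx.1.2⟩
  set p := sSup G with hp
  have hsp : s ≤ p := le_csSup hbdd hsG
  have hpt : p ≤ t := csSup_le ⟨s, hsG⟩ fun x hx => hx.1.2
  have hpG : ∀ a' ∈ Icc s p, ∃ b' ∈ Icc p t, g b' = g a' := by
    intro a' ha'
    by_cases hpa : g p = g a'
    · exact ⟨p, ⟨le_rfl, hpt⟩, hpa⟩
    have hlt : a' < p := lt_of_le_of_ne ha'.2 fun h => hpa (h ▸ rfl)
    have hN : {u | g u ≠ g a'} ∈ 𝓝 p := (isOpen_ne_fun hg continuous_const).mem_nhds hpa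
    obtain ⟨ε, hε, hsub⟩ := Metric.mem_nhds_iff.1 hN
    obtain ⟨x, hxG, hx⟩ := exists_lt_of_lt_csSup ⟨s, hsG⟩ (max_lt hlt (sub_lt_self p hε))
    have hxp : x ≤ p := le_csSup hbdd hxG
    obtain ⟨b', hb', hbe⟩ := hxG.2 a' ⟨ha'.1, (max_lt_iff.1 hx).1.le⟩
    refine ⟨b', ⟨?_, hb'.2⟩, hbe⟩
    by_contra! hbp
    have hball : b' ∈ ball p ε := by
      rw [Real.ball_eq_Ioo]
      exact ⟨by linarith [(max_lt_iff.1 hx).2, hb'.1], by linarith⟩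
    exact hsub hball hbe
  have hnop : ∀ q ∈ Ioc p t, g p ≠ g q := by
    intro q hq h
    have hqb : q < b := hq.2.trans_lt htb
    obtain ⟨ε, hε, hεq, hpart⟩ := exists_partners_right hg ho hy (has.trans_le hsp) hq.1 hqb h
    have hmem : p + ε ∈ G := by
      refine ⟨⟨by linarith, by linarith [hq.2]⟩, fun a' ha' => ?_⟩
      rcases lt_trichotomy a' p with hlt | rfl | hgt
      · obtain ⟨b', hb', hbe⟩ := hpG a' ⟨ha'.1, hlt.le⟩
        refine ⟨b', ⟨?_, hb'.2⟩, hbe⟩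
        by_contra! hbε
        rcases hb'.1.eq_or_lt with rfl | hpb
        · exact not_eq_three hg ho hy (has.trans_le ha'.1) hlt hq.1 hqb hbe.symm h.symm
        · obtain ⟨w, hw, hwe⟩ := hpart b' ⟨hpb, hbε.le⟩
          exact not_eq_three hg ho hy (has.trans_le ha'.1) (hlt.trans hpb) (hbε.trans_le hw.1)
            (hw.2.trans hqb) hbe.symm hwe
      · exact ⟨q, ⟨hεq.le, hq.2⟩, h.symm⟩
      · obtain ⟨w, hw, hwe⟩ := hpart a' ⟨hgt, ha'.2⟩
        exact ⟨w, ⟨hw.1, hw.2.le.trans hq.2⟩, hwe⟩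
    linarith [le_csSup hbdd hmem]
  have hsp' : s < p := lt_of_le_of_ne hsp fun h => hnop t ⟨h ▸ hst, le_rfl⟩ (h ▸ hgst)
  have hpt' : p < t := by
    refine lt_of_le_of_ne hpt fun h => ?_
    obtain ⟨b', hb', hbe⟩ := hpG ((s + t) / 2) ⟨by linarith, by linarith⟩
    obtain rfl : b' = t := le_antisymm hb'.2 (h ▸ hb'.1)
    exact not_eq_three hg ho hy has (by linarith) (by linarith) htb (hgst.trans hbe) hbe
  have hpb : p < b := hpt'.trans htb
  have hinjlt : ∀ x ∈ Icc s p, ∀ z ∈ Icc s p, x < z → g x ≠ g z := by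
    intro x hx z hz hxz h
    have hax : a < x := has.trans_le hx.1
    rcases hz.2.eq_or_lt with rfl | hzp
    · obtain ⟨b', hb', hbe⟩ := hpG ((x + p) / 2) ⟨by linarith [hx.1], by linarith⟩
      have hbb : b' < b := hb'.2.trans_lt htb
      rcases hb'.1.eq_or_lt with hbp | hpb'
      · rw [← hbp] at hbe
        exact not_eq_three hg ho hy hax (by linarith) (by linarith) hpb (h.trans hbe) hbe
      · exact not_linked hg ho hy hax (s' := (x + p) / 2) (by linarith) (by linarith) hpb' hbb h
          hbe.symm
    · obtain ⟨b', hb', hbe⟩ := hpG z hz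
      exact not_eq_three hg ho hy hax hxz (hzp.trans_le hb'.1) (hb'.2.trans_lt htb) h hbe
  have hinjOn : InjOn g (Icc s p) := by
    intro x hx z hz h
    by_contra hne
    rcases lt_or_gt_of_ne hne with hlt | hlt
    · exact hinjlt x hx z hz hlt h
    · exact hinjlt z hz x hx hlt h.symm
  have hsub : g '' Ioo p t ⊆ g '' Ioo s p := by
    rcases (isPreconnected_Ioo.image g hg.continuousOn).subset_or_subset (ho _ isOpen_Ioo)
      (isCompact_Icc.image hg).isClosed.isOpen_compl
      (disjoint_compl_right_iff_subset.2 (image_mono (Ioo_subset_Icc_self (a := s) (b := p)))) (by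
        rintro _ ⟨u, hu, rfl⟩
        by_cases hmem : g u ∈ g '' Icc s p
        · obtain ⟨v, hv, hvu⟩ := hmem
          refine Or.inl ⟨v, ⟨lt_of_le_of_ne hv.1 ?_, lt_of_le_of_ne hv.2 ?_⟩, hvu⟩
          · rintro rfl
            exact not_eq_three hg ho hy has (hsp'.trans hu.1) hu.2 htb hvu (hgst.symm.trans hvu)
          · rintro rfl
            exact hnop u ⟨hu.1, hu.2.le⟩ hvu
        · exact Or.inr hmem) with h | h
    · exact h
    · exfalso
      have hm : (s + p) / 2 ∈ Ioo s p := ⟨by linarith, by linarith⟩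
      have hm' : (s + p) / 2 ∈ Icc s p := Ioo_subset_Icc_self hm
      obtain ⟨b', hb', hbe⟩ := hpG _ hm'
      have h1 : b' ≠ p := by
        rintro rfl
        exact hm.2.ne (hinjOn hm' ⟨hsp, le_rfl⟩ hbe.symm)
      have h2 : b' ≠ t := by
        rintro rfl
        exact hm.1.ne (hinjOn ⟨le_rfl, hsp⟩ hm' (hgst.trans hbe))
      exact h ⟨b', ⟨lt_of_le_of_ne hb'.1 h1.symm, lt_of_le_of_ne hb'.2 h2⟩, rfl⟩
        ⟨_, hm', hbe.symm⟩
  have heq : g '' Ioc s p = g '' Ioo s t := by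
    refine Subset.antisymm (image_mono fun u hu => ⟨hu.1, hu.2.trans_lt hpt'⟩) ?_
    rintro _ ⟨u, hu, rfl⟩
    rcases lt_or_ge p u with hpu | hup
    · exact image_mono Ioo_subset_Ioc_self (hsub ⟨u, ⟨hpu, hu.2⟩, rfl⟩)
    · exact ⟨u, ⟨hu.1, hup⟩, rfl⟩
  exact ⟨s, p, hsp', hinjOn, heq ▸ ho _ isOpen_Ioo⟩

end Folding

section TypeI

theorem tendsto_invFun_lineToIoo_right {a b : ℝ} (hab : a < b) :
    Tendsto (Function.invFun (lineToIoo a b)) (𝓝[>] a) atBot := by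
  have hr := range_lineToIoo hab
  refine tendsto_atBot.2 fun t => ?_
  have ht : a < lineToIoo a b t := (hr ▸ mem_range_self t : lineToIoo a b t ∈ Ioo a b).1
  filter_upwards [Ioo_mem_nhdsGT ht] with x hx
  have hxr : x ∈ range (lineToIoo a b) := hr ▸ ⟨hx.1, hx.2.trans
    (hr ▸ mem_range_self t : lineToIoo a b t ∈ Ioo a b).2⟩
  rw [← (lineToIoo_strictMono hab).le_iff_le, Function.invFun_eq hxr]
  exact hx.2.le

theorem tendsto_invFun_lineToIoo_left {a b : ℝ} (hab : a < b) :
    Tendsto (Function.invFun (lineToIoo a b)) (𝓝[<] b) atTop := by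
  have hr := range_lineToIoo hab
  refine tendsto_atTop.2 fun t => ?_
  have ht : lineToIoo a b t < b := (hr ▸ mem_range_self t : lineToIoo a b t ∈ Ioo a b).2
  filter_upwards [Ioo_mem_nhdsLT ht] with x hx
  have hxr : x ∈ range (lineToIoo a b) := hr ▸ ⟨
    (hr ▸ mem_range_self t : lineToIoo a b t ∈ Ioo a b).1.trans hx.1, hx.2⟩
  rw [← (lineToIoo_strictMono hab).le_iff_le, Function.invFun_eq hxr]
  exact hx.1.le

variable {X : Type*} [MetricSpace X]

theorem isArcEnds_range_union {γ : ℝ → X} (hγ : IsOpenEmbedding γ) {p q : X}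
    (hp : Tendsto γ atBot (𝓝 p)) (hq : Tendsto γ atTop (𝓝 q)) (hpr : p ∉ range γ)
    (hqr : q ∉ range γ) (hpq : p ≠ q) : IsArcEnds (range γ ∪ {p, q}) p q := by
  set ρ := lineToIoo 0 1
  have hρ : IsOpenEmbedding ρ := isOpenEmbedding_lineToIoo zero_lt_one
  have hr : range ρ = Ioo 0 1 := range_lineToIoo zero_lt_one
  set f : ℝ → X := γ ∘ Function.invFun ρ with hf
  have hfc : ContinuousOn f (Ioo 0 1) := hγ.continuous.comp_continuousOn (hr ▸ hρ.continuousOn_invFun)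
  have hf0 : Tendsto f (𝓝[>] 0) (𝓝 p) := hp.comp (tendsto_invFun_lineToIoo_right zero_lt_one)
  have hf1 : Tendsto f (𝓝[<] 1) (𝓝 q) := hq.comp (tendsto_invFun_lineToIoo_left zero_lt_one)
  set φ := extendFrom (Ioo 0 1) f
  have hφ0 : φ 0 = p := eq_lim_at_left_extendFrom_Ioo zero_lt_one hf0
  have hφ1 : φ 1 = q := eq_lim_at_right_extendFrom_Ioo zero_lt_one hf1
  have hφf : ∀ x ∈ Ioo (0 : ℝ) 1, φ x = f x := extendFrom_extends hfc
  have hφr : ∀ x ∈ Ioo (0 : ℝ) 1, φ x ∈ range γ := fun x hx => hφf x hx ▸ mem_range_self _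
  have hcases : ∀ x ∈ Icc (0 : ℝ) 1, x = 0 ∨ x = 1 ∨ x ∈ Ioo (0 : ℝ) 1 := by
    intro x hx
    rcases hx.1.eq_or_lt with rfl | h0
    · exact Or.inl rfl
    rcases hx.2.eq_or_lt with rfl | h1
    · exact Or.inr (Or.inl rfl)
    exact Or.inr (Or.inr ⟨h0, h1⟩)
  refine ⟨φ, continuousOn_Icc_extendFrom_Ioo hfc hf0 hf1, ?_, ?_, hφ0, hφ1⟩
  · intro x hx z hz h
    rcases hcases x hx with rfl | rfl | hx <;> rcases hcases z hz with rfl | rfl | hz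
    · rfl
    · exact absurd (hφ0.symm.trans (h.trans hφ1)) hpq
    · exact absurd (hφ0 ▸ h ▸ hφr z hz) hpr
    · exact absurd (hφ0.symm.trans (h.symm.trans hφ1)) hpq
    · rfl
    · exact absurd (hφ1 ▸ h ▸ hφr z hz) hqr
    · exact absurd (hφ0 ▸ h ▸ hφr x hx) hpr
    · exact absurd (hφ1 ▸ h ▸ hφr x hx) hqr
    · rw [hφf x hx, hφf z hz] at h
      have := congrArg ρ (hγ.injective h)
      rwa [Function.invFun_eq (hr ▸ hx : x ∈ range ρ),
        Function.invFun_eq (hr ▸ hz : z ∈ range ρ)] at this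
  · refine Subset.antisymm ?_ ?_
    · rintro _ ⟨x, hx, rfl⟩
      rcases hcases x hx with rfl | rfl | hx
      · exact Or.inr (Or.inl hφ0)
      · exact Or.inr (Or.inr hφ1)
      · exact Or.inl (hφr x hx)
    · rintro _ (⟨t, rfl⟩ | rfl | rfl)
      · have hmem : ρ t ∈ Ioo (0 : ℝ) 1 := hr ▸ mem_range_self t
        refine ⟨ρ t, Ioo_subset_Icc_self hmem, ?_⟩
        rw [hφf _ hmem, hf, Function.comp_apply, Function.leftInverse_invFun hρ.injective]
      · exact ⟨0, ⟨le_rfl, zero_le_one⟩, hφ0⟩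
      · exact ⟨1, ⟨zero_le_one, le_rfl⟩, hφ1⟩

theorem isOpen_image_Ioc_of_le {g : ℝ → X} (hg : Continuous g) {s p : ℝ} (hi : InjOn g (Icc s p))
    (ho : IsOpen (g '' Ioc s p)) {r : ℝ} (hr : s ≤ r) : IsOpen (g '' Ioc r p) := by
  rcases lt_or_ge p r with hpr | hrp
  · simp [Ioc_eq_empty_of_le hpr.le]
  have : g '' Ioc r p = g '' Ioc s p \ g '' Icc s r := by
    refine Subset.antisymm ?_ ?_
    · rintro _ ⟨u, hu, rfl⟩
      refine ⟨⟨u, ⟨hr.trans_lt hu.1, hu.2⟩, rfl⟩, ?_⟩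
      rintro ⟨v, hv, hvu⟩
      have := hi ⟨hv.1, hv.2.trans hrp⟩ ⟨hr.trans hu.1.le, hu.2⟩ hvu
      linarith [hv.2, hu.1]
    · rintro _ ⟨⟨u, hu, rfl⟩, hn⟩
      exact ⟨u, ⟨not_le.1 fun h => hn ⟨u, ⟨hu.1.le, h⟩, rfl⟩, hu.2⟩, rfl⟩
  rw [this]
  exact ho.sdiff (isCompact_Icc.image hg).isClosed

theorem notMem_freePart_of_fold {g : ℝ → X} (hg : Continuous g) {s p : ℝ} (hsp : s < p)
    (hi : InjOn g (Icc s p)) (ho : IsOpen (g '' Ioc s p)) : g p ∉ freePart X := by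
  intro hM
  obtain ⟨δ, hδ, h0⟩ := mem_freePart_iff.1 hM
  obtain ⟨ε, hε, hsub⟩ := Metric.isOpen_iff.1 (hδ.isOpen_range.preimage hg) p
    (⟨0, h0⟩ : g p ∈ range δ)
  set r := max s (p - ε / 2) with hr
  have hrp : r < p := max_lt hsp (by linarith)
  have hrs : s ≤ r := le_max_left _ _
  have hri : InjOn g (Ioc r p) := 
    hi.mono (Ioc_subset_Icc_self.trans (Icc_subset_Icc_left hrs))
  have hrange : ∀ u ∈ Ioc r p, g u ∈ range δ := by
    intro u hu
    have hball : u ∈ ball p ε := by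
      rw [Real.ball_eq_Ioo]
      exact ⟨by linarith [le_max_right s (p - ε / 2), hu.1], by linarith [hu.2]⟩
    exact hsub hball
  set h : ℝ → ℝ := Function.invFun δ ∘ g with hh
  have hinv : ∀ u ∈ Ioc r p, δ (h u) = g u := fun u hu => Function.invFun_eq (hrange u hu)
  have hpr : p ∈ Ioc r p := ⟨hrp, le_rfl⟩
  have hhi : InjOn h (Ioc r p) := by
    intro u hu v hv huv
    exact hri hu hv (by rw [← hinv u hu, ← hinv v hv, huv])
  have hhc : ContinuousOn h (Ioc r p) := hδ.continuousOn_invFun.comp hg.continuousOn hrange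
  have hopen : IsOpen (h '' Ioc r p) := by
    have : h '' Ioc r p = δ ⁻¹' (g '' Ioc r p) := by
      refine Subset.antisymm ?_ ?_
      · rintro _ ⟨u, hu, rfl⟩
        exact ⟨u, hu, (hinv u hu).symm⟩
      · rintro x ⟨u, hu, hux⟩
        exact ⟨u, hu, hδ.injective ((hinv u hu).trans hux)⟩
    rw [this]
    exact (isOpen_image_Ioc_of_le hg hi ho hrs).preimage hδ.continuous
  obtain ⟨η, hη, hball⟩ := Metric.isOpen_iff.1 hopen (h p) ⟨p, hpr, rfl⟩
  rw [Real.ball_eq_Ioo] at hball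
  have hside : ∀ x ∈ Ioo (h p - η) (h p + η), x ≠ h p → x ∈ h '' Ioo r p := by
    intro x hx hne
    obtain ⟨u, hu, rfl⟩ := hball hx
    exact ⟨u, ⟨hu.1, lt_of_le_of_ne hu.2 fun h => hne (h ▸ rfl)⟩, rfl⟩
  have hoc : (h '' Ioo r p).OrdConnected :=
    (isPreconnected_Ioo.image h (hhc.mono Ioo_subset_Ioc_self)).ordConnected
  obtain ⟨u, hu, hup⟩ := hoc.out
    (hside (h p - η / 2) ⟨by linarith, by linarith⟩ (by linarith))
    (hside (h p + η / 2) ⟨by linarith, by linarith⟩ (by linarith))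
    (⟨by linarith, by linarith⟩ : h p ∈ Icc (h p - η / 2) (h p + η / 2))
  exact hu.2.ne (hhi ⟨hu.1, hu.2.le⟩ hpr hup)

theorem isEndpointOf_of_fold {g : ℝ → X} (hg : Continuous g) {s p : ℝ} (hsp : s < p)
    (hi : InjOn g (Icc s p)) (ho : IsOpen (g '' Ioc s p)) : IsEndpointOf X (g p) := by
  intro U hU hpU
  obtain ⟨ε, hε, hsub⟩ := Metric.isOpen_iff.1 (hU.preimage hg) p hpU
  set r := max s (p - ε / 2) with hr
  have hrp : r < p := max_lt hsp (by linarith)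
  have hrs : s ≤ r := le_max_left _ _
  have hV := isOpen_image_Ioc_of_le hg hi ho hrs
  refine ⟨g '' Ioc r p, hV, ⟨p, ⟨hrp, le_rfl⟩, rfl⟩, ?_, g r, ?_⟩
  · rintro _ ⟨u, hu, rfl⟩
    refine hsub ?_
    rw [Real.ball_eq_Ioo]
    exact ⟨by linarith [le_max_right s (p - ε / 2), hu.1], by linarith [hu.2]⟩
  have hcl : closure (g '' Ioc r p) = g '' Icc r p := by
    refine Subset.antisymm (closure_minimal (image_mono Ioc_subset_Icc_self)
      (isCompact_Icc.image hg).isClosed) ?_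
    rw [← closure_Ioc hrp.ne]
    exact image_closure_subset_closure_image hg
  rw [hV.frontier_eq, hcl]
  refine Subset.antisymm ?_ ?_
  · rintro _ ⟨⟨u, hu, rfl⟩, hn⟩
    rcases hu.1.eq_or_lt with h | h
    · exact h ▸ rfl
    · exact absurd ⟨u, ⟨h, hu.2⟩, rfl⟩ hn
  · rintro _ rfl
    refine ⟨⟨r, ⟨le_rfl, hrp.le⟩, rfl⟩, ?_⟩
    rintro ⟨u, hu, hur⟩
    exact hu.1.ne' (hi ⟨hrs.trans hu.1.le, hu.2⟩ ⟨hrs, hrp.le⟩ hur)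

theorem ne_of_fold {g γ : ℝ → X} (hg : Continuous g) (hγ : IsOpenEmbedding γ) {s p : ℝ}
    (hsp : s < p) (hi : InjOn g (Icc s p)) (ho : IsOpen (g '' Ioc s p))
    (hsub : g '' Ioo s p ⊆ range γ) (hpr : g p ∉ range γ) (hq : Tendsto γ atTop (𝓝 (g p))) {q : X}
    (hq' : Tendsto γ atBot (𝓝 q)) : q ≠ g p := by
  rintro rfl
  set r := (s + p) / 2
  have hsr : s < r := by simp only [r]; linarith
  have hrp : r < p := by simp only [r]; linarith
  have hN : g '' Ioc r p ∈ 𝓝 (g p) :=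
    (isOpen_image_Ioc_of_le hg hi ho hsr.le).mem_nhds ⟨p, ⟨hrp, le_rfl⟩, rfl⟩
  have hmem : ∀ t, γ t ∈ g '' Ioc r p → γ t ∈ g '' Ioo r p := by
    rintro t ⟨u, hu, hut⟩
    refine ⟨u, ⟨hu.1, lt_of_le_of_ne hu.2 ?_⟩, hut⟩
    rintro rfl
    exact hpr ⟨t, hut.symm⟩
  have hsub' : g '' Ioo r p ⊆ range γ := (image_mono (Ioo_subset_Ioo_left hsr.le)).trans hsub
  have hoc := ((isPreconnected_Ioo.image g hg.continuousOn).preimage_of_isOpenMap hγ.injective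
    hγ.isOpenMap hsub').ordConnected
  obtain ⟨t, ht⟩ := hsub ⟨r, ⟨hsr, hrp⟩, rfl⟩
  obtain ⟨t1, h1, ht1⟩ := ((hq.eventually_mem hN).and (eventually_ge_atTop t)).exists
  obtain ⟨t0, h0, ht0⟩ := ((hq'.eventually_mem hN).and (eventually_le_atBot t)).exists
  obtain ⟨u, hu, hut⟩ : γ t ∈ g '' Ioo r p := hoc.out (hmem t0 h0) (hmem t1 h1) ⟨ht0, ht1⟩
  exact hu.1.ne' (hi ⟨hsr.le.trans hu.1.le, hu.2.le⟩ ⟨hsr.le, hrp.le⟩ (hut.trans ht))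

theorem isTypeI_of_fold_of_tendsto {g γ : ℝ → X} (hg : Continuous g) (hγ : IsOpenEmbedding γ)
    (hmax : IsMaxFreeOpenInterval (range γ)) {s p : ℝ}
    (hsp : s < p) (hi : InjOn g (Icc s p)) (ho : IsOpen (g '' Ioc s p))
    (hsub : g '' Ioo s p ⊆ range γ) (hq : Tendsto γ atTop (𝓝 (g p))) {q : X}
    (hq' : Tendsto γ atBot (𝓝 q)) (hqM : q ∉ freePart X)
    (hcl : closure (range γ) = range γ ∪ {q, g p}) : IsTypeI (range γ) := by
  have hpr : g p ∉ range γ := fun h =>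
    notMem_freePart_of_fold hg hsp hi ho (hmax.1.subset_freePart h)
  have hqr : q ∉ range γ := fun h => hqM (hmax.1.subset_freePart h)
  have hne := ne_of_fold hg hγ hsp hi ho hsub hpr hq hq'
  exact ⟨hmax, q, g p, hne, hqr, hpr, hcl, hcl ▸ isArcEnds_range_union hγ hq' hq hqr hpr hne,
    Or.inr (isEndpointOf_of_fold hg hsp hi ho)⟩

variable [CompactSpace X] [ConnectedSpace X] [LocallyConnectedSpace X]

theorem exists_isTypeI_of_fold (hcirc : ¬ SpaceIsCircle X) {g : ℝ → X} (hg : Continuous g)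
    (hgo : IsOpenMap g) {s p : ℝ} (hsp : s < p) (hi : InjOn g (Icc s p))
    (ho : IsOpen (g '' Ioc s p)) : ∃ K : Set X, IsTypeI K := by
  have hA : IsFreeOpenInterval (g '' Ioo s p) :=
    isFreeOpenInterval_image_Ioo hg hgo hsp (hi.mono Ioo_subset_Icc_self)
  obtain ⟨K, hK, hAK⟩ := hA.exists_isMaxFreeOpenInterval
  obtain ⟨γ, hγ, rfl⟩ := isFreeOpenInterval_iff.1 hK.1
  refine ⟨range γ, ?_⟩
  obtain ⟨q0, q1, hq0M, hq1M, hq0, hq1, hcl⟩ := hK.exists_ends hcirc hγ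
  have hpcl : g p ∈ closure (range γ) := by
    refine closure_mono hAK (image_closure_subset_closure_image hg ⟨p, ?_, rfl⟩)
    rw [closure_Ioo hsp.ne]
    exact ⟨hsp.le, le_rfl⟩
  have hpM := notMem_freePart_of_fold hg hsp hi ho
  rw [hcl] at hpcl
  rcases hpcl with h | rfl | rfl
  · exact absurd (hK.1.subset_freePart h) hpM
  · have hr := range_comp_neg γ
    rw [← hr] at hK hcl hAK ⊢
    rw [pair_comm] at hcl
    exact isTypeI_of_fold_of_tendsto hg (isOpenEmbedding_comp_neg hγ) hK hsp hi ho hAK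
      (hq0.comp tendsto_neg_atTop_atBot) (hq1.comp tendsto_neg_atBot_atTop) hq1M hcl
  · exact isTypeI_of_fold_of_tendsto hg hγ hK hsp hi ho hAK hq1 hq0 hq0M hcl

end TypeI

section OpenMaps

variable {X : Type*} [MetricSpace X]

theorem exists_isFreeArc_disjoint_image {K : Set X} (hK : IsFreeOpenInterval K) {f : X → X}
    (hf : Continuous f) (hfK : f '' K ⊆ K) {x : X} (hx : x ∈ K) (hne : f x ≠ x) :
    ∃ A : Set X, IsFreeArc A ∧ A ∩ f '' A = ∅ ∧ A ⊆ K ∧ f '' A ⊆ K := by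
  obtain ⟨γ, hγ, rfl⟩ := isFreeOpenInterval_iff.1 hK
  obtain ⟨t, rfl⟩ := hx
  obtain ⟨N', N, hN', hN, hfN', htN, hd⟩ := t2_separation hne
  obtain ⟨ε, hε, hsub⟩ := Metric.isOpen_iff.1
    ((hN.preimage hγ.continuous).inter (hN'.preimage (hf.comp hγ.continuous))) t ⟨htN, hfN'⟩
  have hlt : t - ε / 2 < t + ε / 2 := by linarith
  have hAK : γ '' Icc (t - ε / 2) (t + ε / 2) ⊆ range γ := image_subset_range _ _
  have hball : Icc (t - ε / 2) (t + ε / 2) ⊆ ball t ε := by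
    rw [Real.ball_eq_Ioo]
    exact fun u hu => ⟨by linarith [hu.1], by linarith [hu.2]⟩
  refine ⟨γ '' Icc (t - ε / 2) (t + ε / 2), ⟨γ '' Ioo (t - ε / 2) (t + ε / 2),
    isFreeOpenInterval_image_Ioo hγ.continuous hγ.isOpenMap hlt hγ.injective.injOn, ?_,
    ⟨(hγ.isEmbedding.homeomorphImage _).symm.trans (iccHomeoI _ _ hlt)⟩⟩, ?_, hAK,
    (image_mono hAK).trans hfK⟩
  · refine Subset.antisymm ?_ (closure_minimal (image_mono Ioo_subset_Icc_self)
      (isCompact_Icc.image hγ.continuous).isClosed)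
    rw [← closure_Ioo hlt.ne]
    exact image_closure_subset_closure_image hγ.continuous
  · rw [← disjoint_iff_inter_eq_empty]
    refine hd.symm.mono ?_ ?_
    · rintro _ ⟨u, hu, rfl⟩
      exact (hsub (hball hu)).1
    · rintro _ ⟨_, ⟨u, hu, rfl⟩, rfl⟩
      exact (hsub (hball hu)).2

variable [CompactSpace X]

theorem exists_isMaxFreeOpenInterval_of_mem_freePart {x : X} (hx : x ∈ freePart X) :
    ∃ K, IsMaxFreeOpenInterval K ∧ x ∈ K := by
  obtain ⟨J, hJ, hxJ⟩ := hx
  obtain ⟨K, hK, hJK⟩ := IsFreeOpenInterval.exists_isMaxFreeOpenInterval hJ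
  exact ⟨K, hK, hJK hxJ⟩

variable [ConnectedSpace X] [LocallyConnectedSpace X]

theorem apply_mem_freePart (hcirc : ¬ SpaceIsCircle X) (hnoI : ∀ J : Set X, ¬ IsTypeI J)
    {f : X → X} (hf : Continuous f) (ho : IsOpenMap f) {x : X} (hx : x ∈ freePart X) :
    f x ∈ freePart X := by
  obtain ⟨γ, hγ, rfl⟩ := mem_freePart_iff.1 hx
  have hg : Continuous (f ∘ γ) := hf.comp hγ.continuous
  have hgo : IsOpenMap (f ∘ γ) := ho.comp hγ.isOpenMap
  have : Nontrivial X := hγ.injective.nontrivial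
  obtain ⟨y, hy⟩ := exists_ne (f (γ 0))
  obtain ⟨r, hr, hsub⟩ := Metric.isOpen_iff.1 (isOpen_ne.preimage hg) 0 hy.symm
  rw [Real.ball_eq_Ioo] at hsub
  have hyg : y ∉ (f ∘ γ) '' Ioo (0 - r) (0 + r) := by
    rintro ⟨u, hu, huy⟩
    exact hsub hu huy
  by_cases hi : InjOn (f ∘ γ) (Ioo (0 - r) (0 + r))
  · exact (isFreeOpenInterval_image_Ioo hg hgo (by linarith) hi).subset_freePart
      ⟨0, ⟨by linarith, by linarith⟩, rfl⟩
  · obtain ⟨s, p, hsp, hinj, hop⟩ := exists_fold hg hgo hyg hi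
    obtain ⟨K, hK⟩ := exists_isTypeI_of_fold hcirc hg hgo hsp hinj hop
    exact absurd hK (hnoI K)

theorem IsMaxFreeOpenInterval.exists_image_subset (hcirc : ¬ SpaceIsCircle X)
    (hnoI : ∀ J : Set X, ¬ IsTypeI J) {f : X → X} (hf : Continuous f) (ho : IsOpenMap f)
    {K : Set X} (hK : IsMaxFreeOpenInterval K) : ∃ K', IsMaxFreeOpenInterval K' ∧ f '' K ⊆ K' := by
  have hM : f '' K ⊆ freePart X := by
    rintro _ ⟨x, hx, rfl⟩
    exact apply_mem_freePart hcirc hnoI hf ho (hK.1.subset_freePart hx)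
  obtain ⟨x, hx⟩ := hK.1.nonempty
  obtain ⟨K', hK', hfx⟩ := exists_isMaxFreeOpenInterval_of_mem_freePart (hM ⟨x, hx, rfl⟩)
  exact ⟨K', hK', hK'.subset_of_isPreconnected hcirc (hK.1.isPreconnected.image f hf.continuousOn) hM
    ⟨f x, ⟨x, hx, rfl⟩, hfx⟩⟩

end OpenMaps

section Semigroups

/-- A transitive relation on a finite nonempty set in which every element has a successor has an
element that is a successor of each of its successors. -/
theorem Set.Finite.exists_recurrent {α : Type*} {B : Set α} (hB : B.Finite) (hne : B.Nonempty)
    {R : α → α → Prop} (htrans : ∀ x y z, R x y → R y z → R x z)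
    (hsucc : ∀ x ∈ B, ∃ y ∈ B, R x y) : ∃ x ∈ B, ∀ y ∈ B, R x y → R y x := by
  obtain ⟨x, hx, hmin⟩ := exists_min_image B (fun x => {y ∈ B | R x y}.ncard) hB hne
  obtain ⟨z, hz, hxz⟩ := hsucc x hx
  refine ⟨z, hz, fun y hy hzy => ?_⟩
  have hsub : {w ∈ B | R y w} ⊆ {w ∈ B | R x w} := fun w hw =>
    ⟨hw.1, htrans x y w (htrans x z y hxz hzy) hw.2⟩
  have heq := eq_of_subset_of_ncard_le hsub (hmin y hy) (hB.subset (sep_subset _ _))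
  have hmem : z ∈ {w ∈ B | R x w} := ⟨hz, hxz⟩
  rw [← heq] at hmem
  exact hmem.2

/-- If a sensitive semigroup maps each member of a family of open sets into a member of the family, and
only finitely many members are large, then some element maps a member into itself without being the
identity there. -/
theorem exists_apply_ne_of_sensitive {X : Type*} [MetricSpace X] [CompactSpace X]
    {P : Set X → Prop} (hPo : ∀ K, P K → IsOpen K ∧ K.Nonempty) (hPne : ∃ K, P K)
    {F : Set (X → X)} (hcont : ∀ f ∈ F, Continuous f) (hsemi : ∀ f ∈ F, ∀ g ∈ F, f ∘ g ∈ F)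
    (hmap : ∀ f ∈ F, ∀ K, P K → ∃ K', P K' ∧ f '' K ⊆ K') {c : ℝ} (hc : 0 < c)
    (hfin : {K | P K ∧ c < diam K}.Finite)
    (hsens : ∀ U : Set X, IsOpen U → U.Nonempty → ∃ f ∈ F, c < diam (f '' U)) :
    ∃ K, P K ∧ ∃ f ∈ F, f '' K ⊆ K ∧ ∃ x ∈ K, f x ≠ x := by
  by_contra! hid
  set B := {K | P K ∧ c < diam K} with hB
  have hbig : ∀ f ∈ F, ∀ K K' U, U ⊆ K → P K' → f '' K ⊆ K' → c < diam (f '' U) → K' ∈ B :=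
    fun f _ K K' U hUK hK' hfK hU => ⟨hK', hU.trans_le
      (diam_mono ((image_mono hUK).trans hfK) (isBounded_of_compactSpace))⟩
  have hsucc : ∀ K, P K → ∃ K' ∈ B, ∃ f ∈ F, f '' K ⊆ K' := by
    intro K hK
    obtain ⟨f, hf, hfc⟩ := hsens K (hPo K hK).1 (hPo K hK).2
    obtain ⟨K', hK', hfK⟩ := hmap f hf K hK
    exact ⟨K', hbig f hf K K' K Subset.rfl hK' hfK hfc, f, hf, hfK⟩
  have hBne : B.Nonempty := by
    obtain ⟨K, hK⟩ := hPne
    obtain ⟨K', hK', -⟩ := hsucc K hK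
    exact ⟨K', hK'⟩
  obtain ⟨K, hK, hrec⟩ := hfin.exists_recurrent hBne (R := fun K K' => ∃ f ∈ F, f '' K ⊆ K')
    (fun K1 K2 K3 ⟨f, hf, hf'⟩ ⟨g, hg, hg'⟩ => ⟨g ∘ f, hsemi g hg f hf, by
      rw [image_comp]; exact (image_mono hf').trans hg'⟩) fun K hK => hsucc K hK.1
  have hagree : ∀ K' ∈ B, ∀ f ∈ F, ∀ f' ∈ F, f '' K ⊆ K' → f' '' K ⊆ K' → EqOn f f' K := by
    intro K' hK' f hf f' hf' hfK hfK' x hx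
    obtain ⟨g, hg, hgK⟩ := hrec K' hK' ⟨f, hf, hfK⟩
    have h1 : g (f x) = x := hid K hK.1 (g ∘ f) (hsemi g hg f hf) (by
      rw [image_comp]; exact (image_mono hfK).trans hgK) x hx
    have h2 : f' (g (f x)) = f x := hid K' hK'.1 (f' ∘ g) (hsemi f' hf' g hg) (by
      rw [image_comp]; exact (image_mono hgK).trans hfK') (f x) (hfK ⟨x, hx, rfl⟩)
    rw [← h2, h1]
  set D := {K' ∈ B | ∃ f ∈ F, f '' K ⊆ K'} with hD
  have hDfin : D.Finite := hfin.subset (sep_subset _ _)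
  obtain ⟨x, hx⟩ := (hPo K hK.1).2
  have : Nonempty X := ⟨x⟩
  choose! φ hφF hφ using fun (K' : Set X) (hK' : K' ∈ D) => hK'.2
  set U := K ∩ ⋂ K' ∈ D, φ K' ⁻¹' ball (φ K' x) (c / 2) with hU
  have hUo : IsOpen U := (hPo K hK.1).1.inter
    (hDfin.isOpen_biInter fun K' hK' => isOpen_ball.preimage (hcont _ (hφF K' hK')))
  obtain ⟨f, hf, hfU⟩ := hsens U hUo
    ⟨x, hx, mem_iInter₂.2 fun K' _ => mem_ball_self (by positivity)⟩
  obtain ⟨K', hK', hfK⟩ := hmap f hf K hK.1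
  have hK'B : K' ∈ B := hbig f hf K K' U inter_subset_left hK' hfK hfU
  have hK'D : K' ∈ D := ⟨hK'B, f, hf, hfK⟩
  have hsub : f '' U ⊆ ball (φ K' x) (c / 2) := by
    rintro _ ⟨u, hu, rfl⟩
    rw [hagree K' hK'B f hf _ (hφF K' hK'D) hfK (hφ K' hK'D) hu.1]
    exact mem_iInter₂.1 hu.2 K' hK'D
  linarith [diam_mono hsub isBounded_ball, diam_ball (x := φ K' x) (half_pos hc).le]

end Semigroups

/-- Claim D: If `X` (Peano continuum with a free arc, neither arc
nor circle) has no maximal free open interval of Type I and `F` is a sensitive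
commutative open-map semigroup with constant `c`, then there are a free arc `A₁`
and `f₁ ∈ F` with `A₁` a jumping arc of `f₁`, and `A₁` and `f₁(A₁)` contained in
the same maximal free open interval. -/
theorem stmt_16 (X : Type*) [MetricSpace X] [CompactSpace X] [ConnectedSpace X]
    [LocallyConnectedSpace X]
    (hfree : ∃ A : Set X, IsFreeArc A)
    (harc : ¬ SpaceIsArc X) (hcirc : ¬ SpaceIsCircle X)
    (hnoI : ∀ J : Set X, ¬ IsTypeI J)
    (F : Set (X → X))
    (hcont : ∀ f ∈ F, Continuous f)
    (hopen : ∀ f ∈ F, IsOpenMap f)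
    (hsemi : ∀ f ∈ F, ∀ g ∈ F, f ∘ g ∈ F)
    (hcomm : ∀ f ∈ F, ∀ g ∈ F, f ∘ g = g ∘ f)
    (c : ℝ) (hc : 0 < c)
    (hsens : ∀ U : Set X, IsOpen U → U.Nonempty → ∃ f ∈ F, c < Metric.diam (f '' U)) :
    ∃ A₁ : Set X, ∃ f₁ ∈ F, IsFreeArc A₁ ∧ A₁ ∩ (f₁ '' A₁) = ∅ ∧
      ∃ J : Set X, IsMaxFreeOpenInterval J ∧ A₁ ⊆ J ∧ f₁ '' A₁ ⊆ J := by
  have hmax : ∃ K : Set X, IsMaxFreeOpenInterval K := by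
    obtain ⟨_, J, hJ, -⟩ := hfree
    obtain ⟨K, hK, -⟩ := IsFreeOpenInterval.exists_isMaxFreeOpenInterval hJ
    exact ⟨K, hK⟩
  obtain ⟨K, hK, f, hf, hfK, x, hx, hne⟩ := exists_apply_ne_of_sensitive
    (P := IsMaxFreeOpenInterval) (fun K hK => ⟨hK.1.1, hK.1.nonempty⟩) hmax hcont hsemi
    (fun f hf K hK => hK.exists_image_subset hcirc hnoI (hcont f hf) (hopen f hf)) hc
    (finite_setOf_lt_diam hcirc hc) hsens
  obtain ⟨A, hA, hdisj, hAK, hfA⟩ := exists_isFreeArc_disjoint_image hK.1 (hcont f hf) hfK hx hne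
  exact ⟨A, f, hf, hA, hdisj, K, hK, hAK, hfA⟩
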